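/- Let s ≥ 1 with nonzero generic parameters a_1, …, a_{2s+2} (absolute convergence, a_1⋯a_{2s+2} ≠ 1, Θ(x_j) ≠ 0). Then for every x = (x_1,…,x_s) ∈ (ℂ*)^s, det( ⟨⟨χ_{(s−i)}, x_j⟩⟩ )_{1 ≤ i, j ≤ s} = (1−q)^s (q)_∞^s · ∏_{1 ≤ i < j ≤ 2s+2} (q a_i^{−1} a_j^{−1})_∞ / (q a_1^{−1} a_2^{−1} ⋯ a_{2s+2}^{−1})_∞ · ∏_{1 ≤ j < k ≤ s} θ(x_j/x_k) θ(x_j x_k) / x_j. In particular, for generic parameters the characters χ_{(s−1)}, χ_{(s−2)}, …, χ_{(0)} give linearly independent regularized BC_1-type Jackson integrals. -/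

import Mathlib

open Complex Finset

noncomputable section

/-- The `q`-shifted factorial `(x;q)_∞ = ∏_{i≥0} (1 - q^i x)`. -/
def qp (q : ℝ) (x : ℂ) : ℂ := ∏' i : ℕ, (1 - (q : ℂ) ^ i * x)

/-- The theta function `θ(x) = (x;q)_∞ (q/x;q)_∞`. -/
def th (q : ℝ) (x : ℂ) : ℂ := qp q x * qp q ((q : ℂ) / x)

/-- `e(x;y) = x + x⁻¹ - (y + y⁻¹)`. -/
def efn (x y : ℂ) : ℂ := x + x⁻¹ - (y + y⁻¹)

/-- The value `Φ(q^ν ξ)` of the `BC₁` weight along the `q`-lattice through `ξ`,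
where the power `(q^ν ξ)^(1/2 - α m)` is interpreted as
`q^(ν/2) * (a m)^(-ν) * ξ^(1/2 - α m)` for the fixed (principal) branch of
`ξ^(1/2 - α m)`. -/
def PhiLat (q : ℝ) (s : ℕ) (a α : Fin (2 * s + 2) → ℂ) (ξ : ℂ) (ν : ℤ) : ℂ :=
  ∏ m, ((q : ℂ) ^ ((ν : ℂ) / 2) * a m ^ (-ν) * ξ ^ ((1 : ℂ) / 2 - α m) *
    (qp q ((q : ℂ) * ((q : ℂ) ^ ν * ξ) / a m) / qp q ((q : ℂ) ^ ν * ξ * a m)))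

/-- The `ν`-th summand `φ(q^ν ξ) Φ(q^ν ξ) Δ(q^ν ξ)` of the `BC₁`-type Jackson
integral `⟨φ,ξ⟩`. -/
def jSummand (q : ℝ) (s : ℕ) (a α : Fin (2 * s + 2) → ℂ) (φ : ℂ → ℂ) (ξ : ℂ) (ν : ℤ) : ℂ :=
  φ ((q : ℂ) ^ ν * ξ) * PhiLat q s a α ξ ν * (((q : ℂ) ^ ν * ξ)⁻¹ - (q : ℂ) ^ ν * ξ)

/-- The `BC₁`-type Jackson integral `⟨φ,ξ⟩ = (1-q) ∑_{ν∈ℤ} φ(q^ν ξ) Φ(q^ν ξ) Δ(q^ν ξ)`. -/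
def jInt (q : ℝ) (s : ℕ) (a α : Fin (2 * s + 2) → ℂ) (φ : ℂ → ℂ) (ξ : ℂ) : ℂ :=
  (1 - (q : ℂ)) * ∑' ν : ℤ, jSummand q s a α φ ξ ν

/-- `Θ(z) = z^(s - α₁ - ⋯ - α_{2s+2}) θ(z²) / ∏_m θ(a_m z)`. -/
def ThetaBC (q : ℝ) (s : ℕ) (a α : Fin (2 * s + 2) → ℂ) (z : ℂ) : ℂ :=
  z ^ ((s : ℂ) - ∑ m, α m) * th q (z ^ 2) / ∏ m, th q (a m * z)

/-- The irreducible `C₁`-character `χ_(i)(z) = (z^(i+1) - z^(-i-1))/(z - z⁻¹)`. -/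
def chiC (i : ℕ) (z : ℂ) : ℂ := (z ^ (i + 1) - z⁻¹ ^ (i + 1)) / (z - z⁻¹)

theorem summable_norm_qp_factor {q : ℝ} (hq0 : 0 < q) (hq1 : q < 1) (x : ℂ) :
    Summable fun i : ℕ => ‖-((q : ℂ) ^ i * x)‖ := by
  simpa [abs_of_pos hq0] using (summable_geometric_of_lt_one hq0.le hq1).mul_right ‖x‖

theorem multipliable_qp {q : ℝ} (hq0 : 0 < q) (hq1 : q < 1) (x : ℂ) :
    Multipliable fun i : ℕ => 1 - (q : ℂ) ^ i * x := by
  simpa [sub_eq_add_neg] using multipliable_one_add_of_summable (summable_norm_qp_factor hq0 hq1 x)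

theorem qp_eq_mul {q : ℝ} (hq0 : 0 < q) (hq1 : q < 1) (x : ℂ) :
    qp q x = (1 - x) * qp q (q * x) := by
  have e : (fun i : ℕ => 1 - (q : ℂ) ^ i * (q * x)) = fun i : ℕ => 1 - (q : ℂ) ^ (i + 1) * x := by
    funext i
    ring
  have h := multipliable_qp hq0 hq1 (q * x)
  rw [e] at h
  have h' := tprod_eq_zero_mul' (f := fun i : ℕ => 1 - (q : ℂ) ^ i * x) h
  rw [pow_zero, one_mul] at h'
  rw [qp, h', qp, e]

theorem qp_ne_zero {q : ℝ} (hq0 : 0 < q) (hq1 : q < 1) {x : ℂ}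
    (h : ∀ i : ℕ, (q : ℂ) ^ i * x ≠ 1) : qp q x ≠ 0 := by
  have := tprod_one_add_ne_zero_of_summable (f := fun i : ℕ => -((q : ℂ) ^ i * x))
    (fun i => by
      rw [← sub_eq_add_neg]
      exact sub_ne_zero.2 (h i).symm) (summable_norm_qp_factor hq0 hq1 x)
  simpa [qp, sub_eq_add_neg] using this

theorem qp_eq_zero {q : ℝ} {x : ℂ} (i : ℕ) (h : (q : ℂ) ^ i * x = 1) : qp q x = 0 :=
  tprod_of_exists_eq_zero ⟨i, by simp [h]⟩

theorem qp_ne_zero_iff {q : ℝ} (hq0 : 0 < q) (hq1 : q < 1) {x : ℂ} :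
    qp q x ≠ 0 ↔ ∀ i : ℕ, (q : ℂ) ^ i * x ≠ 1 :=
  ⟨fun h i hi => h (qp_eq_zero i hi), qp_ne_zero hq0 hq1⟩

theorem tendsto_qp {q : ℝ} (hq0 : 0 < q) (hq1 : q < 1) (x : ℂ) :
    Filter.Tendsto (fun s : Finset ℕ => ∏ i ∈ s, (1 - (q : ℂ) ^ i * x)) Filter.atTop
      (nhds (qp q x)) :=
  (multipliable_qp hq0 hq1 x).hasProd

theorem norm_qp_le {q : ℝ} (hq0 : 0 < q) (hq1 : q < 1) {x : ℂ} {r : ℝ} (h : ‖x‖ ≤ r) :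
    ‖qp q x‖ ≤ ‖qp q (-r)‖ := by
  refine le_of_tendsto_of_tendsto' (tendsto_qp hq0 hq1 x).norm (tendsto_qp hq0 hq1 (-r)).norm
    fun s => ?_
  rw [norm_prod, norm_prod]
  refine prod_le_prod (fun _ _ => norm_nonneg _) fun i _ => ?_
  have hr : 0 ≤ r := (norm_nonneg _).trans h
  have e : (1 - (q : ℂ) ^ i * (-r)) = ((1 + q ^ i * r : ℝ) : ℂ) := by push_cast; ring
  rw [e, Complex.norm_of_nonneg (by positivity)]
  calc ‖1 - (q : ℂ) ^ i * x‖ ≤ ‖(1 : ℂ)‖ + ‖(q : ℂ) ^ i * x‖ := norm_sub_le _ _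
    _ = 1 + q ^ i * ‖x‖ := by simp [abs_of_pos hq0]
    _ ≤ 1 + q ^ i * r := by gcongr

theorem qp_neg_ne_zero {q : ℝ} (hq0 : 0 < q) (hq1 : q < 1) {r : ℝ} (hr : 0 ≤ r) :
    qp q (-r) ≠ 0 := by
  refine qp_ne_zero hq0 hq1 fun i hi => ?_
  have e : (q : ℂ) ^ i * (-r) = ((-(q ^ i * r) : ℝ) : ℂ) := by push_cast; ring
  rw [e] at hi
  have h1 : -(q ^ i * r) = 1 := by exact_mod_cast hi
  have : 0 ≤ q ^ i * r := by positivity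
  linarith

theorem tendsto_qp_zero {q : ℝ} (hq0 : 0 < q) (hq1 : q < 1) :
    Filter.Tendsto (qp q) (nhds 0) (nhds 1) := by
  have hb : ∀ x : ℂ, ‖qp q x - 1‖ ≤ Real.exp ((1 - q)⁻¹ * ‖x‖) - 1 := by
    intro x
    refine le_of_tendsto' ((tendsto_qp hq0 hq1 x).sub_const 1).norm fun s => ?_
    have h1 := norm_prod_one_add_sub_one_le s (fun i => -((q : ℂ) ^ i * x))
    simp only [← sub_eq_add_neg] at h1
    refine h1.trans (sub_le_sub_right (Real.exp_le_exp.2 ?_) 1)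
    have hs := summable_norm_qp_factor hq0 hq1 x
    refine (hs.sum_le_tsum s fun _ _ => norm_nonneg _).trans_eq ?_
    simp [abs_of_pos hq0, tsum_mul_right, tsum_geometric_of_lt_one hq0.le hq1]
  rw [tendsto_iff_norm_sub_tendsto_zero]
  refine squeeze_zero (fun _ => norm_nonneg _) hb ?_
  have : Continuous fun x : ℂ => Real.exp ((1 - q)⁻¹ * ‖x‖) - 1 := by fun_prop
  simpa using this.tendsto 0

theorem ofReal_zpow_ne_zero {q : ℝ} (hq0 : 0 < q) (ν : ℤ) : (q : ℂ) ^ ν ≠ 0 :=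
  zpow_ne_zero _ (by exact_mod_cast hq0.ne')

theorem th_ne_zero_iff {q : ℝ} (hq0 : 0 < q) (hq1 : q < 1) {x : ℂ} (hx : x ≠ 0) :
    th q x ≠ 0 ↔ ∀ ν : ℤ, (q : ℂ) ^ ν * x ≠ 1 := by
  have hq : (q : ℂ) ≠ 0 := by exact_mod_cast hq0.ne'
  rw [th, mul_ne_zero_iff, qp_ne_zero_iff hq0 hq1, qp_ne_zero_iff hq0 hq1]
  have key : ∀ i : ℕ, (q : ℂ) ^ i * (q / x) = 1 ↔ (q : ℂ) ^ (-((i : ℤ) + 1)) * x = 1 := by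
    intro i
    rw [zpow_neg, zpow_add₀ hq, zpow_natCast, zpow_one, ← mul_div_assoc, ← pow_succ,
      div_eq_one_iff_eq hx, inv_mul_eq_one₀ (pow_ne_zero _ hq)]
  constructor
  · rintro ⟨h1, h2⟩ ν hν
    obtain ⟨n, rfl | rfl⟩ := ν.eq_nat_or_neg
    · exact h1 n (by simpa using hν)
    · cases n with
      | zero => exact h1 0 (by simpa using hν)
      | succ n => exact h2 n ((key n).2 (by simpa using hν))
  · intro h
    exact ⟨fun i => by simpa using h i, fun i hi => h _ ((key i).1 hi)⟩

theorem th_zpow_mul_ne_zero {q : ℝ} (hq0 : 0 < q) (hq1 : q < 1) {x : ℂ} (hx : x ≠ 0)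
    (h : th q x ≠ 0) (μ : ℤ) : th q ((q : ℂ) ^ μ * x) ≠ 0 := by
  have hq : (q : ℂ) ≠ 0 := by exact_mod_cast hq0.ne'
  rw [th_ne_zero_iff hq0 hq1 hx] at h
  rw [th_ne_zero_iff hq0 hq1 (mul_ne_zero (ofReal_zpow_ne_zero hq0 μ) hx)]
  intro ν
  rw [← mul_assoc, ← zpow_add₀ hq]
  exact h _

theorem th_mul_left {q : ℝ} (hq0 : 0 < q) (hq1 : q < 1) {x : ℂ} (hx : x ≠ 0) :
    th q (q * x) * -x = th q x := by
  have hq : (q : ℂ) ≠ 0 := by exact_mod_cast hq0.ne'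
  rw [th, th, qp_eq_mul hq0 hq1 x, show (q : ℂ) / (q * x) = x⁻¹ by field_simp,
    qp_eq_mul hq0 hq1 x⁻¹, ← div_eq_mul_inv]
  field_simp
  ring

/-- A point is regular when its square is not an integral power of `q`. -/
def QRegular (q : ℝ) (ξ : ℂ) : Prop := ξ ≠ 0 ∧ ∀ μ : ℤ, (q : ℂ) ^ μ * ξ ^ 2 ≠ 1

/-- The point `q^ν ξ` of the `q`-lattice through `ξ`. -/
def qLat (q : ℝ) (ξ : ℂ) (ν : ℤ) : ℂ := (q : ℂ) ^ ν * ξ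

/-- The factor `(q^(ν²) ξ^(2ν))^p` of the regularized weight. -/
def qGauss (q : ℝ) (p : ℕ) (ξ : ℂ) (ν : ℤ) : ℂ := ((q : ℂ) ^ (ν * ν) * ξ ^ (2 * ν)) ^ p

/-- `(q z²)_∞ (q z⁻²)_∞`. -/
def qDen (q : ℝ) (z : ℂ) : ℂ := qp q (q * z ^ 2) * qp q (q / z ^ 2)

/-- `∏_m (t_m z)_∞ (t_m / z)_∞`. -/
def qNum (q : ℝ) {n : ℕ} (t : Fin n → ℂ) (z : ℂ) : ℂ := ∏ m, (qp q (t m * z) * qp q (t m / z))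

/-- The regularized weight at the lattice point `q^ν ξ`, in the parameters `t_m = q / a_m`. -/
def qWeight (q : ℝ) (p : ℕ) {n : ℕ} (t : Fin n → ℂ) (ξ : ℂ) (ν : ℤ) : ℂ :=
  qGauss q p ξ ν * qNum q t (qLat q ξ ν) / qDen q (qLat q ξ ν)

theorem qRegular_of_th {q : ℝ} (hq0 : 0 < q) (hq1 : q < 1) {ξ : ℂ} (h0 : ξ ≠ 0)
    (h : th q (ξ ^ 2) ≠ 0) : QRegular q ξ :=
  ⟨h0, (th_ne_zero_iff hq0 hq1 (pow_ne_zero 2 h0)).1 h⟩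

theorem QRegular.inv {q : ℝ} {ξ : ℂ} (h : QRegular q ξ) : QRegular q ξ⁻¹ := by
  refine ⟨inv_ne_zero h.1, fun μ hμ => h.2 (-μ) ?_⟩
  rw [zpow_neg, ← inv_inv (ξ ^ 2), ← mul_inv, ← inv_pow, hμ, inv_one]

theorem QRegular.qLat {q : ℝ} (hq0 : 0 < q) {ξ : ℂ} (h : QRegular q ξ) (ν : ℤ) :
    QRegular q (qLat q ξ ν) := by
  have hq : (q : ℂ) ≠ 0 := by exact_mod_cast hq0.ne'
  refine ⟨mul_ne_zero (zpow_ne_zero _ hq) h.1, fun μ hμ => h.2 (μ + (ν + ν)) ?_⟩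
  rw [zpow_add₀ hq, zpow_add₀ hq, ← hμ, _root_.qLat]
  ring

theorem qLat_zero (q : ℝ) (ξ : ℂ) : qLat q ξ 0 = ξ := by simp [qLat]

theorem qLat_succ {q : ℝ} (hq0 : 0 < q) (ξ : ℂ) (ν : ℤ) :
    qLat q ξ (ν + 1) = q * qLat q ξ ν := by
  have hq : (q : ℂ) ≠ 0 := by exact_mod_cast hq0.ne'
  rw [qLat, qLat, zpow_add_one₀ hq]
  ring

theorem qLat_inv_neg (q : ℝ) (ξ : ℂ) (ν : ℤ) : qLat q ξ⁻¹ (-ν) = (qLat q ξ ν)⁻¹ := by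
  simp [qLat, mul_comm]

theorem tendsto_qLat {q : ℝ} (hq0 : 0 < q) (hq1 : q < 1) (ξ : ℂ) :
    Filter.Tendsto (fun n : ℕ => qLat q ξ n) Filter.atTop (nhds 0) := by
  have h : Filter.Tendsto (fun n : ℕ => (q : ℂ) ^ n * ξ) Filter.atTop (nhds (0 * ξ)) :=
    (tendsto_pow_atTop_nhds_zero_of_norm_lt_one (by simpa [abs_of_pos hq0] using hq1)).mul_const ξ
  simpa [qLat] using h

theorem qGauss_zero (q : ℝ) (p : ℕ) (ξ : ℂ) : qGauss q p ξ 0 = 1 := by simp [qGauss]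

theorem qGauss_ne_zero {q : ℝ} (hq0 : 0 < q) (p : ℕ) {ξ : ℂ} (h : ξ ≠ 0) (ν : ℤ) :
    qGauss q p ξ ν ≠ 0 :=
  pow_ne_zero _ (mul_ne_zero (ofReal_zpow_ne_zero hq0 _) (zpow_ne_zero _ h))

theorem qGauss_inv_neg (q : ℝ) (p : ℕ) (ξ : ℂ) (ν : ℤ) :
    qGauss q p ξ⁻¹ (-ν) = qGauss q p ξ ν := by
  rw [qGauss, qGauss, neg_mul_neg, mul_neg, inv_zpow, zpow_neg, inv_inv]

theorem qGauss_succ {q : ℝ} (hq0 : 0 < q) (p : ℕ) {ξ : ℂ} (h : ξ ≠ 0) (ν : ℤ) :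
    qGauss q p ξ (ν + 1) = (q * qLat q ξ ν ^ 2) ^ p * qGauss q p ξ ν := by
  have hq : (q : ℂ) ≠ 0 := by exact_mod_cast hq0.ne'
  rw [qGauss, qGauss, ← mul_pow, qLat]
  congr 1
  rw [show (ν + 1) * (ν + 1) = ν * ν + ν + ν + 1 by ring, show 2 * (ν + 1) = 2 * ν + 1 + 1 by ring]
  simp only [zpow_add₀ hq, zpow_add₀ h, zpow_one]
  ring

theorem qDen_inv (q : ℝ) (z : ℂ) : qDen q z⁻¹ = qDen q z := by
  simp only [qDen, inv_pow, div_inv_eq_mul, ← div_eq_mul_inv]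
  ring

theorem qNum_inv (q : ℝ) {n : ℕ} (t : Fin n → ℂ) (z : ℂ) : qNum q t z⁻¹ = qNum q t z := by
  simp only [qNum, div_inv_eq_mul, ← div_eq_mul_inv]
  exact prod_congr rfl fun m _ => mul_comm _ _

theorem qWeight_inv_neg (q : ℝ) (p : ℕ) {n : ℕ} (t : Fin n → ℂ) (ξ : ℂ) (ν : ℤ) :
    qWeight q p t ξ⁻¹ (-ν) = qWeight q p t ξ ν := by
  rw [qWeight, qWeight, qGauss_inv_neg, qLat_inv_neg, qNum_inv, qDen_inv]

theorem qDen_ne_zero {q : ℝ} (hq0 : 0 < q) (hq1 : q < 1) {z : ℂ} (h : QRegular q z) :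
    qDen q z ≠ 0 := by
  have hq : (q : ℂ) ≠ 0 := by exact_mod_cast hq0.ne'
  refine mul_ne_zero (qp_ne_zero hq0 hq1 fun i => ?_) (qp_ne_zero hq0 hq1 fun i => ?_)
  · rw [← mul_assoc, ← pow_succ]
    exact_mod_cast h.2 ((i + 1 : ℕ) : ℤ)
  · rw [div_eq_mul_inv, ← mul_assoc, ← pow_succ, ← inv_pow]
    exact_mod_cast h.inv.2 ((i + 1 : ℕ) : ℤ)

theorem QRegular.sq_ne_one {q : ℝ} {z : ℂ} (h : QRegular q z) : 1 - z ^ 2 ≠ 0 := by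
  have := h.2 0
  rw [zpow_zero, one_mul] at this
  exact sub_ne_zero.2 this.symm

theorem qDen_mul {q : ℝ} (hq0 : 0 < q) (hq1 : q < 1) {z : ℂ} (hz : z ≠ 0) :
    qDen q (q * z) * (q * z ^ 4 * (1 - q ^ 2 * z ^ 2)) = qDen q z * (1 - z ^ 2) := by
  have hq : (q : ℂ) ≠ 0 := by exact_mod_cast hq0.ne'
  have e1 : qp q (q * z ^ 2) = (1 - q * z ^ 2) * ((1 - q ^ 2 * z ^ 2) * qp q (q * (q * z) ^ 2)) := by
    rw [qp_eq_mul hq0 hq1, qp_eq_mul hq0 hq1 (q * (q * z ^ 2))]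
    ring_nf
  have e2 : qp q (q / (q * z) ^ 2) = (1 - 1 / (q * z ^ 2)) * ((1 - 1 / z ^ 2) * qp q (q / z ^ 2)) := by
    rw [qp_eq_mul hq0 hq1, qp_eq_mul hq0 hq1 (q * (q / (q * z) ^ 2))]
    rw [show (q : ℂ) * (q * (q / (q * z) ^ 2)) = q / z ^ 2 by field_simp,
      show (q : ℂ) * (q / (q * z) ^ 2) = 1 / z ^ 2 by field_simp,
      show (q : ℂ) / (q * z) ^ 2 = 1 / (q * z ^ 2) by field_simp]
  rw [qDen, qDen, e1, e2]
  field_simp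
  ring

theorem qNum_mul {q : ℝ} (hq0 : 0 < q) (hq1 : q < 1) {n : ℕ} (t : Fin n → ℂ) {z : ℂ}
    (hz : z ≠ 0) :
    qNum q t (q * z) * ∏ m, (1 - t m * z) = qNum q t z * ∏ m, (1 - t m / (q * z)) := by
  have hq : (q : ℂ) ≠ 0 := by exact_mod_cast hq0.ne'
  rw [qNum, qNum, ← prod_mul_distrib, ← prod_mul_distrib]
  refine prod_congr rfl fun m _ => ?_
  rw [qp_eq_mul hq0 hq1 (t m * z), qp_eq_mul hq0 hq1 (t m / (q * z)),
    show (q : ℂ) * (t m / (q * z)) = t m / z by field_simp,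
    show (q : ℂ) * (t m * z) = t m * (q * z) by ring]
  ring

/-- A majorant for the summands of degree `d` at the lattice point `q^ν ξ`, for parameters bounded
by `r`. -/
def qBound (q : ℝ) (p d : ℕ) {n : ℕ} (r : Fin n → ℝ) (ξ : ℂ) (ν : ℤ) : ℝ :=
  (‖qLat q ξ ν‖ + ‖qLat q ξ ν‖⁻¹) ^ d * ‖qGauss q p ξ ν‖ *
    (∏ m, (‖qp q (-(r m * ‖qLat q ξ ν‖ : ℝ))‖ * ‖qp q (-(r m / ‖qLat q ξ ν‖ : ℝ))‖)) /
      ‖qDen q (qLat q ξ ν)‖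

theorem qBound_inv_neg (q : ℝ) (p d : ℕ) {n : ℕ} (r : Fin n → ℝ) (ξ : ℂ) (ν : ℤ) :
    qBound q p d r ξ⁻¹ (-ν) = qBound q p d r ξ ν := by
  simp only [qBound, qGauss_inv_neg, qLat_inv_neg, qDen_inv, norm_inv, inv_inv, div_inv_eq_mul,
    ← div_eq_mul_inv]
  rw [add_comm ‖qLat q ξ ν‖⁻¹]
  simp only [mul_comm ‖qp q (-(_ / _ : ℝ))‖]

theorem qBound_pos {q : ℝ} (hq0 : 0 < q) (hq1 : q < 1) (p d : ℕ) {n : ℕ} {r : Fin n → ℝ}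
    (hr : ∀ m, 0 ≤ r m) {ξ : ℂ} (hξ : QRegular q ξ) (ν : ℤ) : 0 < qBound q p d r ξ ν := by
  have hz := hξ.qLat hq0 ν
  have h0 : 0 < ‖qLat q ξ ν‖ := norm_pos_iff.2 hz.1
  have h1 : 0 < ‖qDen q (qLat q ξ ν)‖ := norm_pos_iff.2 (qDen_ne_zero hq0 hq1 hz)
  have h2 : 0 < ‖qGauss q p ξ ν‖ := norm_pos_iff.2 (qGauss_ne_zero hq0 p hξ.1 ν)
  refine div_pos (mul_pos (by positivity) (prod_pos fun m _ => mul_pos ?_ ?_)) h1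
  · exact norm_pos_iff.2 (qp_neg_ne_zero hq0 hq1 (mul_nonneg (hr m) h0.le))
  · exact norm_pos_iff.2 (qp_neg_ne_zero hq0 hq1 (div_nonneg (hr m) h0.le))

theorem norm_qp_neg_mul {q : ℝ} (hq0 : 0 < q) (hq1 : q < 1) {x : ℝ} (hx : 0 ≤ x) :
    ‖qp q (-(x : ℝ))‖ = (1 + x) * ‖qp q (-(q * x : ℝ))‖ := by
  rw [qp_eq_mul hq0 hq1, norm_mul, sub_neg_eq_add]
  congr 1
  · rw [← ofReal_one, ← ofReal_add, Complex.norm_of_nonneg (by positivity)]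
  · simp

theorem qBound_succ {q : ℝ} (hq0 : 0 < q) (hq1 : q < 1) (p d : ℕ) {n : ℕ} (hn : n = 2 * p + 4)
    {r : Fin n → ℝ} (hr : ∀ m, 0 ≤ r m) {ξ : ℂ} (hξ : QRegular q ξ) (ν : ℤ) :
    qBound q p d r ξ (ν + 1) = qBound q p d r ξ ν *
      (((q * ‖qLat q ξ ν‖ ^ 2 + q⁻¹) / (‖qLat q ξ ν‖ ^ 2 + 1)) ^ d *
        (q ^ (p + 1) * ∏ m, ((q * ‖qLat q ξ ν‖ + r m) / (q * (1 + r m * ‖qLat q ξ ν‖)))) *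
        (‖1 - (q : ℂ) ^ 2 * qLat q ξ ν ^ 2‖ / ‖1 - qLat q ξ ν ^ 2‖)) := by
  have hz := hξ.qLat hq0 ν
  have hz' := hξ.qLat hq0 (ν + 1)
  have hD := norm_ne_zero_iff.2 (qDen_ne_zero hq0 hq1 hz)
  have hD' := norm_ne_zero_iff.2 (qDen_ne_zero hq0 hq1 hz')
  have hden := congrArg norm (qDen_mul hq0 hq1 hz.1)
  have h1 := norm_ne_zero_iff.2 hz.sq_ne_one
  rw [qLat_succ hq0] at hz' hD'
  rw [qBound, qBound, qLat_succ hq0, qGauss_succ hq0 p hξ.1]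
  set z := qLat q ξ ν
  have hu : 0 < ‖z‖ := norm_pos_iff.2 hz.1
  simp only [norm_mul, norm_pow, Complex.norm_real, Real.norm_of_nonneg hq0.le] at hden ⊢
  have hprod : ∏ m, (‖qp q (-(r m * (q * ‖z‖) : ℝ))‖ * ‖qp q (-(r m / (q * ‖z‖) : ℝ))‖) =
      (∏ m, (‖qp q (-(r m * ‖z‖ : ℝ))‖ * ‖qp q (-(r m / ‖z‖ : ℝ))‖)) *
      ((∏ m, ((q * ‖z‖ + r m) / (q * (1 + r m * ‖z‖)))) / ‖z‖ ^ n) := by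
    have : ‖z‖ ^ n = ∏ _m : Fin n, ‖z‖ := by simp
    rw [this, ← prod_div_distrib, ← prod_mul_distrib]
    refine prod_congr rfl fun m _ => ?_
    have hm := hr m
    have h3 : 0 < 1 + r m * ‖z‖ := by positivity
    rw [norm_qp_neg_mul hq0 hq1 (x := r m * ‖z‖) (by positivity),
      norm_qp_neg_mul hq0 hq1 (x := r m / (q * ‖z‖)) (by positivity),
      show q * (r m / (q * ‖z‖)) = r m / ‖z‖ by field_simp,
      show q * (r m * ‖z‖) = r m * (q * ‖z‖) by ring]
    field_simp
  rw [hprod]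
  have hd : (q * ‖z‖ + (q * ‖z‖)⁻¹) ^ d =
      (‖z‖ + ‖z‖⁻¹) ^ d * ((q * ‖z‖ ^ 2 + q⁻¹) / (‖z‖ ^ 2 + 1)) ^ d := by
    rw [← mul_pow]
    congr 1
    field_simp
  rw [hd]
  have hden' : ‖qDen q (q * z)‖⁻¹ = ‖qDen q z‖⁻¹ *
      (q * ‖z‖ ^ 4 * (‖1 - (q : ℂ) ^ 2 * z ^ 2‖ / ‖1 - z ^ 2‖)) := by
    field_simp
    linarith
  rw [div_eq_mul_inv, hden']
  have e : (q * ‖z‖ ^ 2) ^ p * (q * ‖z‖ ^ 4) / ‖z‖ ^ n = q ^ (p + 1) := by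
    rw [hn, mul_pow, pow_add ‖z‖, pow_mul]
    field_simp
    ring
  rw [← e]
  ring

theorem summable_qBound_nat {q : ℝ} (hq0 : 0 < q) (hq1 : q < 1) (p d : ℕ) {n : ℕ}
    (hn : n = 2 * p + 4) {r : Fin n → ℝ} (hr : ∀ m, 0 ≤ r m) (hR : ∏ m, r m < q ^ (p + 3 + d))
    {ξ : ℂ} (hξ : QRegular q ξ) : Summable fun k : ℕ => qBound q p d r ξ k := by
  have hpos := qBound_pos hq0 hq1 p d hr hξ
  let ρ : ℂ → ℝ := fun z => ((q * ‖z‖ ^ 2 + q⁻¹) / (‖z‖ ^ 2 + 1)) ^ d *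
        (q ^ (p + 1) * ∏ m, ((q * ‖z‖ + r m) / (q * (1 + r m * ‖z‖)))) *
        (‖1 - (q : ℂ) ^ 2 * z ^ 2‖ / ‖1 - z ^ 2‖)
  have hρ0 : ρ 0 = (∏ m, r m) / q ^ (p + 3 + d) := by
    simp only [ρ, norm_zero]
    simp only [mul_zero, zero_add, add_zero, ne_eq, OfNat.ofNat_ne_zero, not_false_eq_true,
      zero_pow, mul_one, prod_div_distrib, prod_const, card_univ, Fintype.card_fin, sub_zero,
      norm_one, div_one, hn]
    rw [inv_pow, show 2 * p + 4 = (p + 1) + (p + 3) by ring, pow_add, pow_add q (p + 3) d]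
    field_simp
    ring
  have hc : ContinuousAt ρ 0 := by
    have hprod : ContinuousAt (fun z : ℂ => ∏ m, ((q * ‖z‖ + r m) / (q * (1 + r m * ‖z‖)))) 0 := by
      refine tendsto_finsetProd _ fun m _ => ?_
      refine ContinuousAt.div (by fun_prop) (by fun_prop) ?_
      simpa using hq0.ne'
    refine ContinuousAt.mul (ContinuousAt.mul (ContinuousAt.pow (ContinuousAt.div (by fun_prop)
      (by fun_prop) (by simp)) d) (ContinuousAt.mul (by fun_prop) hprod))
      (ContinuousAt.div (by fun_prop) (by fun_prop) (by simp))
  refine summable_of_ratio_test_tendsto_lt_one (l := ρ 0) ?_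
    (Filter.Eventually.of_forall fun k => (hpos k).ne') ?_
  · rw [hρ0]
    exact (div_lt_one (by positivity)).2 hR
  · refine (hc.tendsto.comp (tendsto_qLat hq0 hq1 ξ)).congr fun k => ?_
    have h := qBound_succ hq0 hq1 p d hn hr hξ k
    rw [Real.norm_of_nonneg (hpos _).le, Real.norm_of_nonneg (hpos _).le, Nat.cast_succ, h]
    exact (mul_div_cancel_left₀ _ (hpos k).ne').symm

theorem summable_qBound {q : ℝ} (hq0 : 0 < q) (hq1 : q < 1) (p d : ℕ) {n : ℕ}
    (hn : n = 2 * p + 4) {r : Fin n → ℝ} (hr : ∀ m, 0 ≤ r m) (hR : ∏ m, r m < q ^ (p + 3 + d))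
    {ξ : ℂ} (hξ : QRegular q ξ) : Summable fun ν : ℤ => qBound q p d r ξ ν := by
  refine Summable.of_nat_of_neg (summable_qBound_nat hq0 hq1 p d hn hr hR hξ) ?_
  refine (summable_qBound_nat hq0 hq1 p d hn hr hR hξ.inv).congr fun k => ?_
  rw [← qBound_inv_neg q p d r ξ, neg_neg]

theorem norm_qWeight_le {q : ℝ} (hq0 : 0 < q) (hq1 : q < 1) (p d : ℕ) {n : ℕ} {t : Fin n → ℂ}
    {r : Fin n → ℝ} (hr : ∀ m, ‖t m‖ ≤ r m) (ξ : ℂ) (ν : ℤ) :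
    (‖qLat q ξ ν‖ + ‖qLat q ξ ν‖⁻¹) ^ d * ‖qWeight q p t ξ ν‖ ≤ qBound q p d r ξ ν := by
  rw [qWeight, qBound, norm_div, norm_mul, ← mul_div_assoc, ← mul_assoc, qNum, norm_prod]
  gcongr with m
  rw [norm_mul]
  have h2 := norm_nonneg (qLat q ξ ν)
  gcongr
  · refine norm_qp_le hq0 hq1 ?_
    rw [norm_mul]
    gcongr
    exact hr m
  · refine norm_qp_le hq0 hq1 ?_
    rw [norm_div]
    gcongr
    exact hr m

theorem norm_eval_le_mul_pow (f : Polynomial ℂ) {d : ℕ} (hf : f.natDegree ≤ d) {z : ℂ}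
    (hz : z ≠ 0) : ‖f.eval (z + z⁻¹)‖ ≤
      (∑ k ∈ range (d + 1), ‖f.coeff k‖) * (‖z‖ + ‖z‖⁻¹) ^ d := by
  have hu : 0 < ‖z‖ := norm_pos_iff.2 hz
  have h1 : 1 ≤ ‖z‖ + ‖z‖⁻¹ := by
    rcases le_total 1 ‖z‖ with h | h
    · have : 0 < ‖z‖⁻¹ := by positivity
      linarith
    · have := (one_le_inv₀ hu).2 h
      linarith
  rw [Polynomial.eval_eq_sum_range' (Nat.lt_succ_of_le hf), sum_mul]
  refine (norm_sum_le _ _).trans (sum_le_sum fun k hk => ?_)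
  rw [norm_mul, norm_pow]
  gcongr
  calc ‖z + z⁻¹‖ ^ k ≤ (‖z‖ + ‖z‖⁻¹) ^ k := by
        gcongr
        simpa using norm_add_le z z⁻¹
    _ ≤ (‖z‖ + ‖z‖⁻¹) ^ d := pow_le_pow_right₀ h1 (by simpa [Nat.lt_succ_iff] using hk)

/-- The `ν`-th summand of the regularized Jackson integral of `f(z + z⁻¹)`. -/
def qTerm (q : ℝ) (p : ℕ) {n : ℕ} (t : Fin n → ℂ) (f : Polynomial ℂ) (ξ : ℂ) (ν : ℤ) : ℂ :=
  f.eval (qLat q ξ ν + (qLat q ξ ν)⁻¹) * qWeight q p t ξ ν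

/-- The regularized Jackson integral of `f(z + z⁻¹)`, up to the factor `1 - q`. -/
def qSum (q : ℝ) (p : ℕ) {n : ℕ} (t : Fin n → ℂ) (f : Polynomial ℂ) (ξ : ℂ) : ℂ :=
  ∑' ν : ℤ, qTerm q p t f ξ ν

theorem norm_qTerm_le {q : ℝ} (hq0 : 0 < q) (hq1 : q < 1) (p : ℕ) {d n : ℕ} {t : Fin n → ℂ}
    {r : Fin n → ℝ} (hr : ∀ m, ‖t m‖ ≤ r m) {f : Polynomial ℂ} (hf : f.natDegree ≤ d)
    {ξ : ℂ} (hξ : QRegular q ξ) (ν : ℤ) :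
    ‖qTerm q p t f ξ ν‖ ≤ (∑ k ∈ range (d + 1), ‖f.coeff k‖) * qBound q p d r ξ ν := by
  rw [qTerm, norm_mul]
  refine (mul_le_mul_of_nonneg_right (norm_eval_le_mul_pow f hf (hξ.qLat hq0 ν).1)
    (norm_nonneg _)).trans ?_
  rw [mul_assoc]
  exact mul_le_mul_of_nonneg_left (norm_qWeight_le hq0 hq1 p d hr ξ ν)
    (sum_nonneg fun _ _ => norm_nonneg _)

theorem summable_qTerm {q : ℝ} (hq0 : 0 < q) (hq1 : q < 1) (p : ℕ) {d n : ℕ}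
    (hn : n = 2 * p + 4) {t : Fin n → ℂ} (hR : ∏ m, ‖t m‖ < q ^ (p + 3 + d))
    {f : Polynomial ℂ} (hf : f.natDegree ≤ d) {ξ : ℂ} (hξ : QRegular q ξ) :
    Summable fun ν : ℤ => qTerm q p t f ξ ν :=
  Summable.of_norm_bounded
    ((summable_qBound hq0 hq1 p d hn (fun m => norm_nonneg (t m)) hR hξ).mul_left _)
    fun ν => norm_qTerm_le hq0 hq1 p (fun _ => le_rfl) hf hξ ν

open Polynomial in
theorem mul_eval_S_sub_eval_S {b : ℂ} (hb : b ≠ 0) (j : ℤ) :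
    b * (Chebyshev.S ℂ j).eval (b + b⁻¹) - (Chebyshev.S ℂ (j - 1)).eval (b + b⁻¹) =
      b ^ (j + 1) := by
  induction j using Int.induction_on with
  | zero => simp
  | succ j ih =>
    rw [Chebyshev.S_add_one, add_sub_cancel_right, zpow_add_one₀ hb, ← ih]
    simp only [eval_sub, eval_mul, eval_X]
    field_simp
    ring
  | pred j ih =>
    rw [show (-(j : ℤ) - 1 + 1) = -j by ring]
    rw [zpow_add_one₀ hb] at ih
    have h2 := congrArg (eval (b + b⁻¹)) (Chebyshev.S_sub_two ℂ (-(j : ℤ)))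
    simp only [eval_sub, eval_mul, eval_X] at h2
    rw [show (-(j : ℤ) - 1 - 1) = -j - 2 by ring, h2]
    apply mul_right_cancel₀ hb
    rw [← ih]
    field_simp
    ring

open Polynomial in
theorem eval_S_mul_sub {z : ℂ} (hz : z ≠ 0) (j : ℤ) :
    (Chebyshev.S ℂ j).eval (z + z⁻¹) * (z⁻¹ - z) = z⁻¹ ^ (j + 1) - z ^ (j + 1) := by
  have h1 := mul_eval_S_sub_eval_S hz j
  have h2 := mul_eval_S_sub_eval_S (inv_ne_zero hz) j
  rw [inv_inv, add_comm z⁻¹ z] at h2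
  rw [← h1, ← h2]
  ring

open Polynomial in
theorem natDegree_S_and_monic (n : ℕ) :
    (Chebyshev.S ℂ n).natDegree = n ∧ (Chebyshev.S ℂ n).Monic := by
  induction n using Nat.strong_induction_on with
  | _ n ih =>
    match n with
    | 0 => simp
    | 1 => simp [monic_X]
    | n + 2 =>
      obtain ⟨d0, m0⟩ := ih n (by omega)
      obtain ⟨d1, m1⟩ := ih (n + 1) (by omega)
      have e : Chebyshev.S ℂ ((n + 2 : ℕ) : ℤ) =
          X * Chebyshev.S ℂ ((n + 1 : ℕ) : ℤ) - Chebyshev.S ℂ n := by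
        push_cast
        exact Chebyshev.S_add_two ℂ n
      have hX : (X * Chebyshev.S ℂ ((n + 1 : ℕ) : ℤ)).natDegree = n + 2 := by
        rw [natDegree_X_mul m1.ne_zero, d1]
      have hlt : (Chebyshev.S ℂ (n : ℤ)).degree < (X * Chebyshev.S ℂ ((n + 1 : ℕ) : ℤ)).degree := by
        apply degree_lt_degree
        omega
      rw [e]
      exact ⟨by rw [natDegree_sub_eq_left_of_natDegree_lt (by omega), hX],
        (monic_X.mul m1).sub_of_left hlt⟩

open Polynomial in
theorem coeff_S_of_le (d : ℕ) {i : ℤ} (h1 : -d - 2 ≤ i) (h2 : i ≤ d) :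
    (Chebyshev.S ℂ i).natDegree ≤ d ∧
      (Chebyshev.S ℂ i).coeff d = if i = d then 1 else if i = -d - 2 then -1 else 0 := by
  have key : ∀ j : ℕ, j ≤ d → (Chebyshev.S ℂ j).natDegree ≤ d ∧
      (Chebyshev.S ℂ j).coeff d = if j = d then 1 else 0 := by
    intro j hj
    obtain ⟨hd, hm⟩ := natDegree_S_and_monic j
    refine ⟨hd.trans_le hj, ?_⟩
    split_ifs with h
    · subst h
      rwa [Monic, leadingCoeff, hd] at hm
    · exact coeff_eq_zero_of_natDegree_lt (by omega)
  rcases lt_trichotomy i (-1) with h | h | h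
  · obtain ⟨j, hj⟩ := Int.eq_ofNat_of_zero_le (show 0 ≤ -i - 2 by omega)
    obtain rfl : i = -(j : ℤ) - 2 := by omega
    obtain ⟨k1, k2⟩ := key j (by omega)
    rw [Chebyshev.S_neg_sub_two, natDegree_neg, coeff_neg, k2]
    refine ⟨k1, ?_⟩
    split_ifs <;> first | omega | simp
  · subst h
    rw [Chebyshev.S_neg_one, if_neg (by omega), if_neg (by omega)]
    simp
  · obtain ⟨j, rfl⟩ := Int.eq_ofNat_of_zero_le (show 0 ≤ i by omega)
    obtain ⟨k1, k2⟩ := key j (by omega)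
    refine ⟨k1, k2.trans ?_⟩
    split_ifs <;> first | omega | rfl

open Polynomial in
/-- The antisymmetrization of `z^(-p-2) (1 - b z) Q(z)` is `z⁻¹ - z` times a polynomial in
`z + z⁻¹`, whose top coefficient and value at `b + b⁻¹` are explicit. -/
theorem exists_antisymmetrization (p : ℕ) {b : ℂ} (hb : b ≠ 0) (Q : ℂ[X])
    (hQ : Q.natDegree ≤ 2 * p + 3) :
    ∃ P : ℂ[X], P.natDegree ≤ p + 1 ∧ P.coeff (p + 1) = Q.coeff 0 + b * Q.coeff (2 * p + 3) ∧
      P.eval (b + b⁻¹) = b⁻¹ ^ (p + 1) * Q.eval b ∧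
      ∀ z : ℂ, z ≠ 0 → P.eval (z + z⁻¹) * (z⁻¹ - z) =
        z⁻¹ ^ (p + 2) * ((1 - b * z) * Q.eval z) -
          z ^ (p + 2) * ((1 - b * z⁻¹) * Q.eval z⁻¹) := by
  have hev : ∀ z : ℂ, Q.eval z = ∑ k ∈ range (2 * p + 4), Q.coeff k * z ^ k := fun z =>
    eval_eq_sum_range' (by omega) z
  have hS := fun i h1 h2 => coeff_S_of_le (p + 1) (i := i) h1 h2
  refine ⟨∑ k ∈ range (2 * p + 4), C (Q.coeff k) *
    (C b * Chebyshev.S ℂ ((k : ℤ) - p - 2) - Chebyshev.S ℂ ((k : ℤ) - p - 2 - 1)),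
    ?_, ?_, ?_, ?_⟩
  · refine natDegree_sum_le_of_forall_le _ _ fun k hk => ?_
    have hk' := mem_range.1 hk
    refine natDegree_C_mul_le _ _ |>.trans ((natDegree_sub_le _ _).trans (max_le ?_ ?_))
    · exact (natDegree_C_mul_le _ _).trans (hS _ (by push_cast; omega) (by push_cast; omega)).1
    · exact (hS _ (by push_cast; omega) (by push_cast; omega)).1
  · rw [finsetSum_coeff]
    have : ∀ k ∈ range (2 * p + 4), (C (Q.coeff k) * (C b * Chebyshev.S ℂ ((k : ℤ) - p - 2) -
        Chebyshev.S ℂ ((k : ℤ) - p - 2 - 1))).coeff (p + 1) =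
        (if k = 0 then Q.coeff k else 0) + (if k = 2 * p + 3 then b * Q.coeff k else 0) := by
      intro k hk
      have hk' := mem_range.1 hk
      rw [coeff_C_mul, coeff_sub, coeff_C_mul,
        (hS _ (by push_cast; omega) (by push_cast; omega)).2,
        (hS _ (by push_cast; omega) (by push_cast; omega)).2]
      push_cast
      split_ifs <;> first | omega | ring
    rw [sum_congr rfl this, sum_add_distrib]
    simp
  · rw [eval_finsetSum, hev, mul_sum]
    refine sum_congr rfl fun k _ => ?_
    rw [eval_C_mul, eval_sub, eval_C_mul, mul_eval_S_sub_eval_S hb,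
      show (k : ℤ) - p - 2 + 1 = k - (p + 1 : ℕ) by push_cast; ring, zpow_sub₀ hb, zpow_natCast,
      zpow_natCast, inv_pow]
    ring
  · intro z hz
    rw [eval_finsetSum, hev, hev, mul_sum, mul_sum, mul_sum, mul_sum, sum_mul, ← sum_sub_distrib]
    refine sum_congr rfl fun k _ => ?_
    have h1 := eval_S_mul_sub hz ((k : ℤ) - p - 2)
    have h2 := eval_S_mul_sub hz ((k : ℤ) - p - 2 - 1)
    rw [sub_add_cancel] at h2
    rw [zpow_add_one₀ hz, zpow_add_one₀ (inv_ne_zero hz)] at h1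
    rw [eval_C_mul, eval_sub, eval_C_mul]
    have e : z ^ ((k : ℤ) - p - 2) = z⁻¹ ^ (p + 2) * z ^ k := by
      rw [show (k : ℤ) - p - 2 = k - (p + 2 : ℕ) by push_cast; ring, zpow_sub₀ hz, zpow_natCast,
        zpow_natCast, inv_pow]
      field_simp
    have e' : z⁻¹ ^ ((k : ℤ) - p - 2) = z ^ (p + 2) * z⁻¹ ^ k := by
      rw [inv_zpow, e]
      simp [mul_comm]
    rw [e, e'] at h1 h2
    linear_combination Q.coeff k * b * h1 - Q.coeff k * h2

open Polynomial in
theorem det_linear_monic {s : ℕ} (L : ℂ[X] →ₗ[ℂ] (Fin s → ℂ)) (f : Fin s → ℂ[X])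
    (hd : ∀ i, (f i).natDegree = i) (hm : ∀ i, (f i).Monic) :
    (Matrix.of fun i => L (f i)).det = (Matrix.of fun i : Fin s => L (X ^ (i : ℕ))).det := by
  have h := Matrix.det_matrixOfPolynomials f hd hm
  have e : (Matrix.of fun i => L (f i)) =
      (Matrix.of fun i j : Fin s => (f j).coeff i).transpose *
        (Matrix.of fun i : Fin s => L (X ^ (i : ℕ))) := by
    ext i j
    simp only [Matrix.mul_apply, Matrix.of_apply, Matrix.transpose_apply]
    have hlt : (f i).natDegree < s := (hd i).trans_lt i.2
    conv_lhs => rw [(f i).as_sum_range' s hlt]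
    rw [map_sum, Finset.sum_apply, ← Fin.sum_univ_eq_sum_range (fun k => L (monomial k ((f i).coeff k)) j)]
    refine sum_congr rfl fun k _ => ?_
    rw [← C_mul_X_pow_eq_monomial, ← smul_eq_C_mul, map_smul, Pi.smul_apply, smul_eq_mul]
  rw [e, Matrix.det_mul, Matrix.det_transpose, h, one_mul]

theorem det_shift_of_relation {s : ℕ} (v : ℕ → Fin (s + 1) → ℂ) (c : ℕ → ℂ)
    (h : ∑ k ∈ range (s + 2), c k • v k = 0) :
    c (s + 1) * (Matrix.of fun i : Fin (s + 1) => v (i + 1)).det =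
      (-1) ^ (s + 1) * c 0 * (Matrix.of fun i : Fin (s + 1) => v i).det := by
  set A : Matrix (Fin (s + 1)) (Fin (s + 1)) ℂ := Matrix.of fun i : Fin (s + 1) => v (i + 1)
  have h1 : c (s + 1) • v (s + 1) = -(c 0 • v 0) + ∑ k : Fin s, (-c (k + 1)) • v (k + 1) := by
    rw [sum_range_succ, sum_range_succ', ← Fin.sum_univ_eq_sum_range
      (fun k => c (k + 1) • v (k + 1))] at h
    simp only [neg_smul, sum_neg_distrib]
    linear_combination (exp := 1) h
  have h2 : c (s + 1) * A.det = (A.updateRow (Fin.last s) (c (s + 1) • v (s + 1))).det := by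
    rw [Matrix.det_updateRow_smul]
    congr 2
    ext i j
    refine Fin.lastCases ?_ (fun i => ?_) i
    · simp [A]
    · rw [Matrix.updateRow_ne (Fin.castSucc_lt_last i).ne]
  have h3 : (A.updateRow (Fin.last s) (∑ k : Fin s, (-c (k + 1)) • v (k + 1))).det = 0 := by
    have h := Matrix.det_updateRow_sum A (Fin.last s)
      (Fin.snoc (α := fun _ => ℂ) (fun k : Fin s => -c (k + 1)) 0)
    have hrow : ∀ k : Fin s, A k.castSucc = v (k + 1) := fun k => rfl
    simpa only [Fin.sum_univ_castSucc, Fin.snoc_castSucc, Fin.snoc_last, zero_smul, add_zero, hrow]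
      using h
  have h4 : A.updateRow (Fin.last s) (v 0) =
      (Matrix.of fun i : Fin (s + 1) => v i).submatrix (finRotate (s + 1)) id := by
    ext i j
    refine Fin.lastCases ?_ (fun i => ?_) i
    · simp
    · rw [Matrix.updateRow_ne (Fin.castSucc_lt_last i).ne]
      simp [A]
  rw [h2, h1, Matrix.det_updateRow_add, h3, add_zero, ← neg_smul, Matrix.det_updateRow_smul, h4,
    Matrix.det_permute, sign_finRotate]
  simp only [add_tsub_cancel_right, Units.val_pow_eq_pow_val, Units.val_neg, Units.val_one,
    Int.cast_pow, Int.cast_neg, Int.cast_one]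
  ring

open Polynomial in
theorem det_linear_mul_sub_C {s : ℕ} (L : ℂ[X] →ₗ[ℂ] (Fin (s + 1) → ℂ)) {P : ℂ[X]}
    (hP : P.natDegree ≤ s + 1) (hL : L P = 0) (c : ℂ) :
    P.coeff (s + 1) * (Matrix.of fun i : Fin (s + 1) => L ((X - C c) * X ^ (i : ℕ))).det =
      (-1) ^ (s + 1) * P.eval c * (Matrix.of fun i : Fin (s + 1) => L (X ^ (i : ℕ))).det := by
  have hd : ∀ i : Fin (s + 1), ((X - C c) ^ (i : ℕ)).natDegree = (i : ℕ) := fun i => by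
    rw [natDegree_pow, natDegree_X_sub_C, mul_one]
  have hm : ∀ i : Fin (s + 1), ((X - C c) ^ (i : ℕ)).Monic := fun i => (monic_X_sub_C c).pow _
  have e1 := det_linear_monic (L ∘ₗ LinearMap.mulLeft ℂ (X - C c)) _ hd hm
  have e2 := det_linear_monic L _ hd hm
  simp only [LinearMap.coe_comp, Function.comp_apply, LinearMap.mulLeft_apply] at e1
  rw [← e1, ← e2]
  have hdT : (taylor c P).natDegree < s + 2 := by
    rw [natDegree_taylor]
    omega
  have hsum : P = ∑ k ∈ range (s + 2), (taylor c P).coeff k • (X - C c) ^ k := by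
    conv_lhs => rw [← sum_taylor_eq P c]
    rw [sum_over_range' _ (by simp) (s + 2) hdT]
    simp [smul_eq_C_mul]
  have hrel : ∑ k ∈ range (s + 2), (taylor c P).coeff k • L ((X - C c) ^ k) = 0 := by
    simp only [← map_smul, ← map_sum]
    rw [← hsum, hL]
  have h := det_shift_of_relation (fun k => L ((X - C c) ^ k)) _ hrel
  have h0 : (taylor c P).coeff 0 = P.eval c := taylor_coeff_zero c P
  have htop : (taylor c P).coeff (s + 1) = P.coeff (s + 1) := by
    conv_rhs => rw [hsum]
    rw [finsetSum_coeff, sum_range_succ, sum_eq_zero, zero_add, coeff_smul, smul_eq_mul]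
    · have := (monic_X_sub_C c).pow (s + 1)
      have hdd : ((X - C c) ^ (s + 1)).natDegree = s + 1 := by
        rw [natDegree_pow, natDegree_X_sub_C, mul_one]
      have h5 : ((X - C c) ^ (s + 1)).coeff (s + 1) = 1 := by
        simpa [Monic, leadingCoeff, hdd] using this
      rw [h5, mul_one]
    · intro k hk
      rw [coeff_smul, coeff_eq_zero_of_natDegree_lt (p := (X - C c) ^ k), smul_zero]
      rw [natDegree_pow, natDegree_X_sub_C, mul_one]
      exact mem_range.1 hk
  rw [h0, htop] at h
  simpa only [pow_succ'] using h

/-- The telescoping sequence behind the linear relation between regularized Jackson integrals. -/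
def qTel (q : ℝ) (p : ℕ) {n : ℕ} (t : Fin n → ℂ) (ξ : ℂ) (ν : ℤ) : ℂ :=
  qWeight q p t ξ ν * ((qLat q ξ ν)⁻¹ ^ (p + 2) * ∏ m, (1 - t m / q * qLat q ξ ν)) /
    ((qLat q ξ ν)⁻¹ - qLat q ξ ν)

theorem qTel_succ {q : ℝ} (hq0 : 0 < q) (hq1 : q < 1) (p : ℕ) {n : ℕ}
    (t : Fin n → ℂ) {ξ : ℂ} (hξ : QRegular q ξ) (ν : ℤ) :
    qTel q p t ξ (ν + 1) =
      qWeight q p t ξ ν * (qLat q ξ ν ^ (p + 2) * ∏ m, (1 - t m / q * (qLat q ξ ν)⁻¹)) /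
        ((qLat q ξ ν)⁻¹ - qLat q ξ ν) := by
  have hq : (q : ℂ) ≠ 0 := by exact_mod_cast hq0.ne'
  have hz := hξ.qLat hq0 ν
  have hz' := hξ.qLat hq0 (ν + 1)
  have hD := qDen_ne_zero hq0 hq1 hz
  have hD' := qDen_ne_zero hq0 hq1 hz'
  have h1 := hz.sq_ne_one
  have h1' := hz'.sq_ne_one
  have hden := qDen_mul hq0 hq1 hz.1
  have hnum := qNum_mul hq0 hq1 t hz.1
  rw [qLat_succ hq0] at hz' hD' h1'
  rw [qTel, qWeight, qWeight, qLat_succ hq0, qGauss_succ hq0 p hξ.1]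
  set z := qLat q ξ ν
  have hz0 := hz.1
  have e1 : ∏ m, (1 - t m / q * (q * z)) = ∏ m, (1 - t m * z) :=
    prod_congr rfl fun m _ => by field_simp
  have e2 : ∏ m, (1 - t m / q * z⁻¹) = ∏ m, (1 - t m / (q * z)) :=
    prod_congr rfl fun m _ => by field_simp
  have e3 : z⁻¹ - z = (1 - z ^ 2) / z := by field_simp
  have e4 : (q * z)⁻¹ - q * z = (1 - (q * z) ^ 2) / (q * z) := by field_simp
  have h1'' : (1 - (q : ℂ) ^ 2 * z ^ 2) ≠ 0 := by rwa [← mul_pow]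
  rw [e1, e2, e3, e4]
  have e5 : (q * z)⁻¹ ^ (p + 2) * (q * z) * (q * z ^ 2) ^ p * q = z ^ (p + 3) / (z ^ 4) := by
    rw [inv_pow, eq_div_iff (pow_ne_zero 4 hz0)]
    field_simp
    ring
  calc _ = qGauss q p ξ ν * ((q * z)⁻¹ ^ (p + 2) * (q * z) * (q * z ^ 2) ^ p) *
        (qNum q t (q * z) * ∏ m, (1 - t m * z)) / (qDen q (q * z) * (1 - (q * z) ^ 2)) := by
        generalize ∏ m, (1 - t m * z) = r
        generalize (q * z)⁻¹ ^ (p + 2) = w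
        field_simp
    _ = qGauss q p ξ ν * ((q * z)⁻¹ ^ (p + 2) * (q * z) * (q * z ^ 2) ^ p * q * z ^ 4) *
        (qNum q t z * ∏ m, (1 - t m / (q * z))) /
        (qDen q (q * z) * (q * z ^ 4 * (1 - q ^ 2 * z ^ 2))) := by
        rw [hnum]
        generalize ∏ m, (1 - t m / (q * z)) = r
        generalize (q * z)⁻¹ ^ (p + 2) = w
        field_simp
    _ = qGauss q p ξ ν * (qNum q t z * ∏ m, (1 - t m / (q * z))) *
        (z ^ (p + 3)) / (qDen q z * (1 - z ^ 2)) := by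
        rw [hden, e5]
        generalize ∏ m, (1 - t m / (q * z)) = r
        field_simp
    _ = _ := by
        generalize ∏ m, (1 - t m / (q * z)) = r
        rw [pow_succ z (p + 2)]
        field_simp

theorem qTel_succ_eq_neg {q : ℝ} (hq0 : 0 < q) (hq1 : q < 1) (p : ℕ) {n : ℕ}
    (t : Fin n → ℂ) {ξ : ℂ} (hξ : QRegular q ξ) (ν : ℤ) :
    qTel q p t ξ (ν + 1) = -qTel q p t ξ⁻¹ (-ν) := by
  rw [qTel_succ hq0 hq1 p t hξ, qTel, qWeight_inv_neg, qLat_inv_neg, inv_inv, ← div_neg,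
    neg_sub]

theorem tendsto_qTel {q : ℝ} (hq0 : 0 < q) (hq1 : q < 1) (p : ℕ) {n : ℕ} (hn : n = 2 * p + 4)
    {t : Fin n → ℂ} (hR : ∏ m, ‖t m‖ < q ^ (2 * p + 4)) {ξ : ℂ} (hξ : QRegular q ξ) :
    Filter.Tendsto (fun k : ℕ => qTel q p t ξ k) Filter.atTop (nhds 0) := by
  have hs := summable_qBound_nat hq0 hq1 p (p + 1) hn (fun m => norm_nonneg (t m))
    (hR.trans_eq (by ring)) hξ
  let g : ℂ → ℂ := fun z => (∏ m, (1 - t m / q * z)) / (1 - z ^ 2)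
  have hg : ContinuousAt g 0 := by
    refine ContinuousAt.div ?_ (by fun_prop) (by simp)
    exact tendsto_finsetProd _ fun m _ =>
      (show ContinuousAt (fun z : ℂ => 1 - t m / q * z) 0 by fun_prop)
  have hlim := hs.tendsto_atTop_zero.mul ((hg.tendsto.comp (tendsto_qLat hq0 hq1 ξ)).norm)
  rw [zero_mul] at hlim
  refine squeeze_zero_norm (fun k => ?_) hlim
  have hz := hξ.qLat hq0 k
  have hb := norm_qWeight_le hq0 hq1 p (p + 1) (fun m => le_refl ‖t m‖) ξ k
  rw [qTel]
  set z := qLat q ξ k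
  have hz0 := hz.1
  have h1 := hz.sq_ne_one
  have e : qWeight q p t ξ k * (z⁻¹ ^ (p + 2) * ∏ m, (1 - t m / q * z)) / (z⁻¹ - z) =
      z⁻¹ ^ (p + 1) * qWeight q p t ξ k * g z := by
    have e3 : z⁻¹ - z = (1 - z ^ 2) / z := by field_simp
    simp only [g]
    rw [e3, pow_succ _ (p + 1)]
    generalize ∏ m, (1 - t m / q * z) = r
    generalize z⁻¹ ^ (p + 1) = w
    field_simp
  rw [e, norm_mul, norm_mul, norm_pow, norm_inv]
  refine mul_le_mul_of_nonneg_right (le_trans ?_ hb) (norm_nonneg _)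
  gcongr
  exact le_add_of_nonneg_left (norm_nonneg _)

theorem qSum_eq_zero {q : ℝ} (hq0 : 0 < q) (hq1 : q < 1) (p : ℕ) {n : ℕ} (hn : n = 2 * p + 4)
    {t : Fin n → ℂ} (hR : ∏ m, ‖t m‖ < q ^ (2 * p + 4)) {ξ : ℂ} (hξ : QRegular q ξ)
    {P : Polynomial ℂ} (hP : ∀ z : ℂ, z ≠ 0 → P.eval (z + z⁻¹) * (z⁻¹ - z) =
        z⁻¹ ^ (p + 2) * (∏ m, (1 - t m / q * z)) -
          z ^ (p + 2) * ∏ m, (1 - t m / q * z⁻¹)) (hd : P.natDegree ≤ p + 1) :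
    qSum q p t P ξ = 0 := by
  have hsum := summable_qTerm hq0 hq1 p (d := p + 1) hn (hR.trans_eq (by ring)) hd hξ
  have hdiff : ∀ ν, qTerm q p t P ξ ν = qTel q p t ξ ν - qTel q p t ξ (ν + 1) := by
    intro ν
    rw [qTel_succ hq0 hq1 p t hξ, qTel, qTerm, ← sub_div, ← mul_sub]
    have hz := hξ.qLat hq0 ν
    rw [← hP _ hz.1]
    have hz0 := hz.1
    have h1 := hz.sq_ne_one
    have h2 : (qLat q ξ ν)⁻¹ - qLat q ξ ν ≠ 0 := by
      rw [show (qLat q ξ ν)⁻¹ - qLat q ξ ν = (1 - qLat q ξ ν ^ 2) / qLat q ξ ν by field_simp]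
      exact div_ne_zero h1 hz0
    field_simp
  have hpos : HasSum (fun k : ℕ => qTerm q p t P ξ k) (qTel q p t ξ 0) := by
    have hs : Summable fun k : ℕ => qTerm q p t P ξ k :=
      hsum.comp_injective Nat.cast_injective
    refine hs.hasSum_iff_tendsto_nat.2 ?_
    have h := (tendsto_qTel hq0 hq1 p hn hR hξ).const_sub (qTel q p t ξ 0)
    rw [sub_zero] at h
    refine h.congr fun N => ?_
    simp only [hdiff]
    have := sum_range_sub' (fun k : ℕ => qTel q p t ξ k) N
    push_cast at this
    exact this.symm
  have hneg : HasSum (fun k : ℕ => qTerm q p t P ξ (-((k : ℤ) + 1))) (-qTel q p t ξ 0) := by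
    have hs : Summable fun k : ℕ => qTerm q p t P ξ (-((k : ℤ) + 1)) :=
      hsum.comp_injective (i := fun k : ℕ => -((k : ℤ) + 1)) fun a b hab => by simpa using hab
    refine hs.hasSum_iff_tendsto_nat.2 ?_
    have h0 : Filter.Tendsto (fun k : ℕ => qTel q p t ξ (-(k : ℤ))) Filter.atTop (nhds 0) := by
      have h := ((tendsto_qTel hq0 hq1 p hn hR hξ.inv).comp
        (Filter.tendsto_add_atTop_nat 1)).neg
      rw [neg_zero] at h
      refine h.congr fun k => ?_
      have e := qTel_succ_eq_neg hq0 hq1 p t hξ (-(k + 1 : ℕ) : ℤ)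
      rw [neg_neg] at e
      rw [Function.comp_apply, ← e]
      congr 1
      push_cast
      ring
    have h := h0.sub_const (qTel q p t ξ 0)
    rw [zero_sub] at h
    refine h.congr fun N => ?_
    simp only [hdiff]
    have := sum_range_sub (fun k : ℕ => qTel q p t ξ (-(k : ℤ))) N
    push_cast at this
    rw [neg_zero] at this
    rw [← this]
    refine sum_congr rfl fun k _ => ?_
    congr 2
    ring
  have h := HasSum.of_nat_of_neg_add_one hpos hneg
  rw [add_neg_cancel] at h
  exact h.tsum_eq

theorem qSum_eq_sum {q : ℝ} (hq0 : 0 < q) (hq1 : q < 1) (p : ℕ) {d n : ℕ}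
    (hn : n = 2 * p + 4) {t : Fin n → ℂ} (hR : ∏ m, ‖t m‖ < q ^ (p + 3 + d))
    {f : Polynomial ℂ} (hf : f.natDegree ≤ d) {ξ : ℂ} (hξ : QRegular q ξ) :
    qSum q p t f ξ = ∑ k ∈ range (d + 1), f.coeff k * qSum q p t (Polynomial.X ^ k) ξ := by
  have hs : ∀ k ∈ range (d + 1), Summable fun ν : ℤ => f.coeff k * qTerm q p t (Polynomial.X ^ k) ξ ν :=
    fun k hk => (summable_qTerm hq0 hq1 p hn hR
      ((Polynomial.natDegree_X_pow k).trans_le (Nat.lt_succ_iff.1 (mem_range.1 hk))) hξ).mul_left _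
  simp only [qSum, ← tsum_mul_left]
  rw [← Summable.tsum_finsetSum hs]
  refine tsum_congr fun ν => ?_
  rw [qTerm, Polynomial.eval_eq_sum_range' (Nat.lt_succ_of_le hf), sum_mul]
  refine sum_congr rfl fun k _ => ?_
  rw [qTerm, Polynomial.eval_pow, Polynomial.eval_X, mul_assoc]

/-- The linear map sending `f` to the regularized Jackson integrals of its truncation to degree at
most `d` at the points `x`. -/
def qSumLin (q : ℝ) (p d : ℕ) {n s : ℕ} (t : Fin n → ℂ) (x : Fin s → ℂ) :
    Polynomial ℂ →ₗ[ℂ] (Fin s → ℂ) :=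
  ∑ k ∈ range (d + 1), (Polynomial.lcoeff ℂ k).smulRight
    fun j => qSum q p t (Polynomial.X ^ k) (x j)

theorem qSumLin_apply {q : ℝ} (hq0 : 0 < q) (hq1 : q < 1) (p : ℕ) {d n s : ℕ}
    (hn : n = 2 * p + 4) {t : Fin n → ℂ} (hR : ∏ m, ‖t m‖ < q ^ (p + 3 + d))
    {f : Polynomial ℂ} (hf : f.natDegree ≤ d) {x : Fin s → ℂ} (hx : ∀ j, QRegular q (x j)) :
    qSumLin q p d t x f = fun j => qSum q p t f (x j) := by
  funext j
  rw [qSum_eq_sum hq0 hq1 p hn hR hf (hx j)]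
  simp [qSumLin, LinearMap.sum_apply, Finset.sum_apply]

/-- The determinant of the regularized Jackson integrals of `1, y, …, y^p`, `y = z + z⁻¹`. -/
def qDet (q : ℝ) (p : ℕ) {n : ℕ} (t : Fin n → ℂ) (x : Fin (p + 1) → ℂ) : ℂ :=
  (Matrix.of fun i j : Fin (p + 1) => qSum q p t (Polynomial.X ^ (i : ℕ)) (x j)).det

theorem qNum_update {q : ℝ} (hq0 : 0 < q) (hq1 : q < 1) {n : ℕ} (t : Fin n → ℂ) (k : Fin n)
    (z : ℂ) :
    qNum q t z = (1 - t k * z) * (1 - t k / z) * qNum q (Function.update t k (q * t k)) z := by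
  rw [qNum, qNum, ← mul_prod_erase univ _ (mem_univ k),
    ← mul_prod_erase univ (fun m => qp q (Function.update t k (q * t k) m * z) *
      qp q (Function.update t k (q * t k) m / z)) (mem_univ k)]
  have e : ∏ m ∈ univ.erase k, (qp q (Function.update t k (q * t k) m * z) *
      qp q (Function.update t k (q * t k) m / z)) =
      ∏ m ∈ univ.erase k, (qp q (t m * z) * qp q (t m / z)) :=
    prod_congr rfl fun m hm => by rw [Function.update_of_ne (ne_of_mem_erase hm)]
  rw [e, Function.update_self, qp_eq_mul hq0 hq1 (t k * z), qp_eq_mul hq0 hq1 (t k / z)]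
  simp only [mul_assoc, mul_div_assoc]
  ring

open Polynomial in
theorem qTerm_update {q : ℝ} (hq0 : 0 < q) (hq1 : q < 1) (p : ℕ) {n : ℕ} (t : Fin n → ℂ)
    {k : Fin n} (hk : t k ≠ 0) (f : ℂ[X]) {ξ : ℂ} (hξ : QRegular q ξ) (ν : ℤ) :
    qTerm q p t f ξ ν = -t k * qTerm q p (Function.update t k (q * t k))
      ((X - C (t k + (t k)⁻¹)) * f) ξ ν := by
  have hz := (hξ.qLat hq0 ν).1
  rw [qTerm, qTerm, qWeight, qWeight, qNum_update hq0 hq1 t k]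
  simp only [eval_mul, eval_sub, eval_X, eval_C]
  generalize qNum q (Function.update t k (q * t k)) (qLat q ξ ν) = N
  have e : (1 - t k * qLat q ξ ν) * (1 - t k / qLat q ξ ν) =
      -t k * (qLat q ξ ν + (qLat q ξ ν)⁻¹ - (t k + (t k)⁻¹)) := by
    field_simp
    ring
  rw [e]
  ring

open Polynomial in
theorem qDet_update {q : ℝ} (hq0 : 0 < q) (hq1 : q < 1) (p : ℕ) {n : ℕ} (hn : n = 2 * p + 4)
    {t : Fin n → ℂ} {k : Fin n} (hk : t k ≠ 0) (hR : ∏ m, ‖t m‖ < q ^ (2 * p + 3))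
    {x : Fin (p + 1) → ℂ} (hx : ∀ j, QRegular q (x j)) :
    (1 - (∏ m, t m) / q ^ (2 * p + 3)) * qDet q p t x =
      (∏ m ∈ univ.erase k, (1 - t m * t k / q)) *
        qDet q p (Function.update t k (q * t k)) x := by
  have hq : (q : ℂ) ≠ 0 := by exact_mod_cast hq0.ne'
  set t' := Function.update t k (q * t k) with ht'
  have hcard : (univ.erase k).card = 2 * p + 3 := by
    rw [card_erase_of_mem (mem_univ k), card_univ, Fintype.card_fin, hn]
    omega
  have hsplit : ∀ g : ℂ → ℂ, ∏ m, g (t' m) = g (q * t k) * ∏ m ∈ univ.erase k, g (t m) := by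
    intro g
    rw [← mul_prod_erase univ _ (mem_univ k), ht', Function.update_self]
    congr 1
    exact prod_congr rfl fun m hm => by rw [Function.update_of_ne (ne_of_mem_erase hm)]
  have hR' : ∏ m, ‖t' m‖ < q ^ (2 * p + 4) := by
    have h1 := congrArg norm (hsplit id)
    simp only [id, norm_mul, norm_prod, mul_assoc, mul_prod_erase univ (fun m => ‖t m‖) (mem_univ k),
      norm_real, Real.norm_of_nonneg hq0.le] at h1
    rw [h1, pow_succ']
    gcongr
  let Q : ℂ[X] := ∏ m ∈ univ.erase k, (1 - C (t m / q) * X)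
  have hdeg1 : ∀ m, (1 - C (t m / q) * X : ℂ[X]).natDegree ≤ 1 := fun m => by
    refine (natDegree_sub_le _ _).trans (max_le (by simp) ?_)
    exact (natDegree_C_mul_le _ _).trans natDegree_X_le
  have hQ : Q.natDegree ≤ 2 * p + 3 := by
    refine (natDegree_prod_le _ _).trans ((sum_le_sum fun m _ => hdeg1 m).trans ?_)
    simp [hcard]
  have hQe : ∀ z, Q.eval z = ∏ m ∈ univ.erase k, (1 - t m / q * z) := fun z => by
    simp [Q, eval_prod]
  have hQ0 : Q.coeff 0 = 1 := by
    rw [coeff_zero_eq_eval_zero, hQe]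
    simp
  have hQtop : Q.coeff (2 * p + 3) = -(∏ m ∈ univ.erase k, t m) / q ^ (2 * p + 3) := by
    have h := coeff_prod_of_natDegree_le (univ.erase k) (fun m => (1 - C (t m / q) * X : ℂ[X])) 1
      fun m _ => hdeg1 m
    rw [hcard, mul_one] at h
    rw [h]
    have e : ∀ m, (1 - C (t m / q) * X : ℂ[X]).coeff 1 = -(t m / q) := fun m => by
      simp [coeff_one]
    simp only [e]
    rw [prod_neg, hcard, prod_div_distrib, prod_const, hcard, pow_add, pow_mul]
    norm_num
    ring
  obtain ⟨P, hPd, hPtop, hPc, hPrel⟩ := exists_antisymmetrization p hk Q hQ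
  have hb : q * t k / q = t k := by field_simp
  have hP0 : qSumLin q p (p + 1) t' x P = 0 := by
    rw [qSumLin_apply hq0 hq1 p hn (hR'.trans_eq (by ring)) hPd hx]
    funext j
    refine qSum_eq_zero hq0 hq1 p hn hR' (hx j) (fun z hz => ?_) hPd
    rw [hPrel z hz, hQe, hQe, hsplit fun u => 1 - u / q * z, hsplit fun u => 1 - u / q * z⁻¹, hb]
  have h := det_linear_mul_sub_C (qSumLin q p (p + 1) t' x) hPd hP0 (t k + (t k)⁻¹)
  have hL : ∀ f : ℂ[X], f.natDegree ≤ p + 1 →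
      qSumLin q p (p + 1) t' x f = fun j => qSum q p t' f (x j) := fun f hf =>
    qSumLin_apply hq0 hq1 p hn (hR'.trans_eq (by ring)) hf hx
  have e1 : (Matrix.of fun i : Fin (p + 1) => qSumLin q p (p + 1) t' x (X ^ (i : ℕ))).det =
      qDet q p t' x := by
    rw [qDet]
    congr 1
    ext i j
    simp only [Matrix.of_apply]
    rw [hL _ (by rw [natDegree_X_pow]; omega)]
  have e2 : qDet q p t x = (-t k) ^ (p + 1) * (Matrix.of fun i : Fin (p + 1) =>
      qSumLin q p (p + 1) t' x ((X - C (t k + (t k)⁻¹)) * X ^ (i : ℕ))).det := by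
    have := Matrix.det_smul (Matrix.of fun i : Fin (p + 1) =>
      qSumLin q p (p + 1) t' x ((X - C (t k + (t k)⁻¹)) * X ^ (i : ℕ))) (-t k)
    rw [Fintype.card_fin] at this
    rw [← this, qDet]
    congr 1
    ext i j
    simp only [Matrix.of_apply, Matrix.smul_apply, smul_eq_mul]
    rw [hL]
    · simp only [qSum, ← tsum_mul_left]
      exact tsum_congr fun ν => qTerm_update hq0 hq1 p t hk _ (hx j) ν
    · refine natDegree_mul_le.trans ?_
      rw [natDegree_X_sub_C, natDegree_X_pow]
      omega
  rw [e1] at h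
  have hT : P.coeff (p + 1) = 1 - (∏ m, t m) / q ^ (2 * p + 3) := by
    rw [hPtop, hQ0, hQtop, ← mul_prod_erase univ t (mem_univ k)]
    ring
  rw [← hT, e2, mul_left_comm, h, hPc, hQe, neg_pow, inv_pow]
  have e3 : ∏ m ∈ univ.erase k, (1 - t m / q * t k) = ∏ m ∈ univ.erase k, (1 - t m * t k / q) :=
    prod_congr rfl fun m _ => by ring
  rw [e3]
  have e4 : ((-1 : ℂ) ^ (p + 1)) * (-1) ^ (p + 1) = 1 := by rw [← mul_pow]; simp
  have e5 : t k ^ (p + 1) * (t k ^ (p + 1))⁻¹ = 1 := mul_inv_cancel₀ (pow_ne_zero _ hk)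
  linear_combination (∏ m ∈ univ.erase k, (1 - t m * t k / q)) * qDet q p t' x *
    (t k ^ (p + 1) * (t k ^ (p + 1))⁻¹ * e4 + e5)

/-- The product `∏_{i<j} (t_i t_j / q)_∞ / (t_1 ⋯ t_n / q^(2p+3))_∞`. -/
def qProd (q : ℝ) (p : ℕ) {n : ℕ} (t : Fin n → ℂ) : ℂ :=
  (∏ i, ∏ j ∈ Ioi i, qp q (t i * t j / q)) / qp q ((∏ m, t m) / q ^ (2 * p + 3))

theorem norm_prod_div_lt_one {q : ℝ} (hq0 : 0 < q) {p n : ℕ} {t : Fin n → ℂ}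
    (hR : ∏ m, ‖t m‖ < q ^ (2 * p + 3)) : ‖(∏ m, t m) / (q : ℂ) ^ (2 * p + 3)‖ < 1 := by
  rw [norm_div, norm_prod, norm_pow, norm_real, Real.norm_of_nonneg hq0.le]
  exact (div_lt_one (by positivity)).2 hR

theorem prod_prod_Ioi_ite {n : ℕ} (h : Fin n → ℂ) (k : Fin n) :
    ∏ i, ∏ j ∈ Ioi i, ((if i = k then h j else 1) * (if j = k then h i else 1)) =
      ∏ m ∈ univ.erase k, h m := by
  have e : univ.erase k = (Ioi k).disjUnion (Iio k) (disjoint_Ioi_Iio k) := by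
    ext m
    simp [eq_comm, lt_or_lt_iff_ne]
  simp only [prod_mul_distrib]
  rw [e, prod_disjUnion]
  congr 1
  · rw [prod_eq_single k (fun i _ hi => by simp [hi]) (by simp)]
    simp
  · simp only [prod_ite_eq', mem_Ioi]
    rw [← prod_filter]
    exact prod_congr (by ext; simp) fun _ _ => rfl

theorem qProd_update {q : ℝ} (hq0 : 0 < q) (hq1 : q < 1) (p : ℕ) {n : ℕ}
    {t : Fin n → ℂ} (k : Fin n) (hR : ∏ m, ‖t m‖ < q ^ (2 * p + 3)) :
    (1 - (∏ m, t m) / q ^ (2 * p + 3)) * qProd q p t =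
      (∏ m ∈ univ.erase k, (1 - t m * t k / q)) *
        qProd q p (Function.update t k (q * t k)) := by
  have hB : 1 - (∏ m, t m) / (q : ℂ) ^ (2 * p + 3) ≠ 0 := fun h => by
    have := norm_prod_div_lt_one hq0 hR
    rw [← sub_eq_zero.1 h, norm_one] at this
    exact this.false
  have hT : ∏ m, Function.update t k (q * t k) m = q * ∏ m, t m := by
    rw [← mul_prod_erase univ _ (mem_univ k), ← mul_prod_erase univ t (mem_univ k),
      Function.update_self, mul_assoc]
    congr 2
    exact prod_congr rfl fun m hm => by rw [Function.update_of_ne (ne_of_mem_erase hm)]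
  have hN : ∏ i, ∏ j ∈ Ioi i, qp q (t i * t j / q) =
      (∏ m ∈ univ.erase k, (1 - t m * t k / q)) * ∏ i, ∏ j ∈ Ioi i,
        qp q (Function.update t k (q * t k) i * Function.update t k (q * t k) j / q) := by
    rw [← prod_prod_Ioi_ite (fun m => 1 - t m * t k / q) k, ← prod_mul_distrib]
    refine prod_congr rfl fun i _ => ?_
    rw [← prod_mul_distrib]
    refine prod_congr rfl fun j hj => ?_
    have hij : i < j := mem_Ioi.1 hj
    by_cases hi : i = k
    · subst hi
      rw [Function.update_self, Function.update_of_ne hij.ne', if_pos rfl, if_neg hij.ne',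
        qp_eq_mul hq0 hq1, mul_one, mul_comm (t i) (t j)]
      congr 2
      ring
    · by_cases hj : j = k
      · subst hj
        rw [Function.update_self, Function.update_of_ne hij.ne, if_neg hij.ne, if_pos rfl,
          qp_eq_mul hq0 hq1, one_mul]
        congr 2
        ring
      · simp [hi, hj]
  rw [qProd, qProd, hT, hN, qp_eq_mul hq0 hq1 ((∏ m, t m) / q ^ (2 * p + 3)), ← mul_div_assoc,
    mul_div_mul_left _ _ hB, mul_div_assoc, mul_div_assoc (q : ℂ)]

/-- Passing from `t` to `t'` multiplies the determinant and its product formula by the same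
factor. -/
def QRel (q : ℝ) (p : ℕ) {n : ℕ} (x : Fin (p + 1) → ℂ) (t t' : Fin n → ℂ) : Prop :=
  ∃ ρ : ℂ, qDet q p t x = ρ * qDet q p t' x ∧ qProd q p t = ρ * qProd q p t'

theorem QRel.trans {q : ℝ} {p n : ℕ} {x : Fin (p + 1) → ℂ} {t t' t'' : Fin n → ℂ}
    (h : QRel q p x t t') (h' : QRel q p x t' t'') : QRel q p x t t'' := by
  obtain ⟨ρ, h1, h2⟩ := h
  obtain ⟨ρ', h1', h2'⟩ := h'
  exact ⟨ρ * ρ', by rw [h1, h1', mul_assoc], by rw [h2, h2', mul_assoc]⟩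

theorem qRel_update {q : ℝ} (hq0 : 0 < q) (hq1 : q < 1) (p : ℕ) {n : ℕ} (hn : n = 2 * p + 4)
    {t : Fin n → ℂ} {k : Fin n} (hk : t k ≠ 0) (hR : ∏ m, ‖t m‖ < q ^ (2 * p + 3))
    {x : Fin (p + 1) → ℂ} (hx : ∀ j, QRegular q (x j)) :
    QRel q p x t (Function.update t k (q * t k)) := by
  have hB : 1 - (∏ m, t m) / (q : ℂ) ^ (2 * p + 3) ≠ 0 := fun h => by
    have := norm_prod_div_lt_one hq0 hR
    rw [← sub_eq_zero.1 h, norm_one] at this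
    exact this.false
  refine ⟨(∏ m ∈ univ.erase k, (1 - t m * t k / q)) / (1 - (∏ m, t m) / (q : ℂ) ^ (2 * p + 3)),
    ?_, ?_⟩
  · rw [div_mul_eq_mul_div, ← qDet_update hq0 hq1 p hn hk hR hx, mul_div_cancel_left₀ _ hB]
  · rw [div_mul_eq_mul_div, ← qProd_update hq0 hq1 p k hR, mul_div_cancel_left₀ _ hB]

theorem qRel_scale_on {q : ℝ} (hq0 : 0 < q) (hq1 : q < 1) (p : ℕ) {n : ℕ} (hn : n = 2 * p + 4)
    {t : Fin n → ℂ} (ht : ∀ m, t m ≠ 0) (hR : ∏ m, ‖t m‖ < q ^ (2 * p + 3))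
    {x : Fin (p + 1) → ℂ} (hx : ∀ j, QRegular q (x j)) (F : Finset (Fin n)) :
    QRel q p x t fun m => if m ∈ F then q * t m else t m := by
  induction F using Finset.induction_on with
  | empty => exact ⟨1, by simp, by simp⟩
  | insert k F hk ih =>
    refine ih.trans ?_
    have e : (fun m => if m ∈ insert k F then q * t m else t m) =
        Function.update (fun m => if m ∈ F then q * t m else t m) k
          (q * (fun m => if m ∈ F then q * t m else t m) k) := by
      funext m
      by_cases h : m = k
      · subst h
        simp [hk]
      · simp [h]
    rw [e]
    refine qRel_update hq0 hq1 p hn (by simp [hk, ht]) (lt_of_le_of_lt ?_ hR) hx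
    refine prod_le_prod (fun _ _ => norm_nonneg _) fun m _ => ?_
    split_ifs
    · rw [norm_mul, norm_real, Real.norm_of_nonneg hq0.le]
      exact mul_le_of_le_one_left (norm_nonneg _) hq1.le
    · exact le_rfl

theorem prod_norm_pow_mul_le {q : ℝ} (hq0 : 0 < q) (hq1 : q < 1) {n : ℕ} (t : Fin n → ℂ) (N : ℕ)
    (m : Fin n) : ‖(q : ℂ) ^ N * t m‖ ≤ ‖t m‖ := by
  rw [norm_mul, norm_pow, norm_real, Real.norm_of_nonneg hq0.le]
  exact mul_le_of_le_one_left (norm_nonneg _) (pow_le_one₀ hq0.le hq1.le)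

theorem qRel_pow_mul {q : ℝ} (hq0 : 0 < q) (hq1 : q < 1) (p : ℕ) {n : ℕ} (hn : n = 2 * p + 4)
    {t : Fin n → ℂ} (ht : ∀ m, t m ≠ 0) (hR : ∏ m, ‖t m‖ < q ^ (2 * p + 3))
    {x : Fin (p + 1) → ℂ} (hx : ∀ j, QRegular q (x j)) (N : ℕ) :
    QRel q p x t fun m => (q : ℂ) ^ N * t m := by
  have hq : (q : ℂ) ≠ 0 := by exact_mod_cast hq0.ne'
  induction N with
  | zero => exact ⟨1, by simp, by simp⟩
  | succ N ih =>
    have h := qRel_scale_on hq0 hq1 p hn (t := fun m => (q : ℂ) ^ N * t m)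
      (fun m => mul_ne_zero (pow_ne_zero _ hq) (ht m)) (lt_of_le_of_lt
        (prod_le_prod (fun _ _ => norm_nonneg _) fun m _ => prod_norm_pow_mul_le hq0 hq1 t N m) hR)
      hx univ
    simp only [mem_univ, if_true, ← mul_assoc, ← pow_succ'] at h
    exact ih.trans h

theorem qp_zero (q : ℝ) : qp q 0 = 1 := by simp [qp]

theorem tendsto_pow_mul_zero {q : ℝ} (hq0 : 0 < q) (hq1 : q < 1) (c : ℂ) :
    Filter.Tendsto (fun N : ℕ => (q : ℂ) ^ N * c) Filter.atTop (nhds 0) := by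
  simpa [qLat] using tendsto_qLat hq0 hq1 c

theorem tendsto_qTerm_pow_mul {q : ℝ} (hq0 : 0 < q) (hq1 : q < 1) (p : ℕ) {n : ℕ}
    (t : Fin n → ℂ) (f : Polynomial ℂ) (ξ : ℂ) (ν : ℤ) :
    Filter.Tendsto (fun N : ℕ => qTerm q p (fun m => (q : ℂ) ^ N * t m) f ξ ν) Filter.atTop
      (nhds (qTerm q p (0 : Fin n → ℂ) f ξ ν)) := by
  simp only [qTerm, qWeight]
  refine Filter.Tendsto.const_mul _ (Filter.Tendsto.div_const (Filter.Tendsto.const_mul _ ?_) _)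
  refine tendsto_finsetProd _ fun m _ => ?_
  simp only [Pi.zero_apply, zero_mul, zero_div, qp_zero, mul_assoc, mul_div_assoc]
  exact ((tendsto_qp_zero hq0 hq1).comp (tendsto_pow_mul_zero hq0 hq1 _)).mul
    ((tendsto_qp_zero hq0 hq1).comp (tendsto_pow_mul_zero hq0 hq1 _))

theorem tendsto_qDet_pow_mul {q : ℝ} (hq0 : 0 < q) (hq1 : q < 1) (p : ℕ) {n : ℕ}
    (hn : n = 2 * p + 4) {t : Fin n → ℂ} (hR : ∏ m, ‖t m‖ < q ^ (2 * p + 3))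
    {x : Fin (p + 1) → ℂ} (hx : ∀ j, QRegular q (x j)) :
    Filter.Tendsto (fun N : ℕ => qDet q p (fun m => (q : ℂ) ^ N * t m) x) Filter.atTop
      (nhds (qDet q p (0 : Fin n → ℂ) x)) := by
  have hc : Continuous fun A : Matrix (Fin (p + 1)) (Fin (p + 1)) ℂ => A.det :=
    continuous_id.matrix_det
  refine (hc.tendsto _).comp (tendsto_pi_nhds.2 fun i => tendsto_pi_nhds.2 fun j => ?_)
  simp only [Matrix.of_apply, qSum]
  have hd : (Polynomial.X ^ (i : ℕ) : Polynomial ℂ).natDegree ≤ p := by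
    rw [Polynomial.natDegree_X_pow]
    omega
  refine tendsto_tsum_of_dominated_convergence ((summable_qBound hq0 hq1 p p hn
    (fun m => norm_nonneg (t m)) (hR.trans_eq (by ring)) (hx j)).mul_left _)
    (fun ν => tendsto_qTerm_pow_mul hq0 hq1 p t _ _ ν) (Filter.Eventually.of_forall fun N ν =>
      norm_qTerm_le hq0 hq1 p (fun m => prod_norm_pow_mul_le hq0 hq1 t N m) hd (hx j) ν)

theorem tendsto_qProd_pow_mul {q : ℝ} (hq0 : 0 < q) (hq1 : q < 1) (p : ℕ) {n : ℕ}
    (hn : n = 2 * p + 4) (t : Fin n → ℂ) :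
    Filter.Tendsto (fun N : ℕ => qProd q p (fun m => (q : ℂ) ^ N * t m)) Filter.atTop
      (nhds 1) := by
  have h0 := fun m => tendsto_pow_mul_zero hq0 hq1 (t m)
  have hqp := tendsto_qp_zero hq0 hq1
  rw [← div_one (1 : ℂ)]
  refine Filter.Tendsto.div ?_ (hqp.comp ?_) one_ne_zero
  · have e : (1 : ℂ) = ∏ i : Fin n, ∏ j ∈ Ioi i, 1 := by simp
    rw [e]
    refine tendsto_finsetProd _ fun i _ => tendsto_finsetProd _ fun j _ => hqp.comp ?_
    simpa using ((h0 i).mul (h0 j)).div_const (q : ℂ)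
  · have h := (tendsto_finsetProd univ fun m _ => h0 m).div_const ((q : ℂ) ^ (2 * p + 3))
    subst hn
    simpa using h

/-- The dependence of the determinant on the parameters. -/
theorem qDet_eq_qProd_mul {q : ℝ} (hq0 : 0 < q) (hq1 : q < 1) (p : ℕ) {n : ℕ}
    (hn : n = 2 * p + 4) {t : Fin n → ℂ} (ht : ∀ m, t m ≠ 0)
    (hR : ∏ m, ‖t m‖ < q ^ (2 * p + 3)) {x : Fin (p + 1) → ℂ} (hx : ∀ j, QRegular q (x j)) :
    qDet q p t x = qProd q p t * qDet q p (0 : Fin n → ℂ) x := by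
  have h1 := (tendsto_qProd_pow_mul hq0 hq1 p hn t).const_mul (qDet q p t x)
  have h2 := (tendsto_qDet_pow_mul hq0 hq1 p hn hR hx).const_mul (qProd q p t)
  rw [mul_one] at h1
  refine tendsto_nhds_unique (h1.congr fun N => ?_) h2
  obtain ⟨ρ, e1, e2⟩ := qRel_pow_mul hq0 hq1 p hn ht hR hx N
  rw [e1, e2]
  ring

/-- The symmetric factor `(qu/v)_∞ (qv/u)_∞ (quv)_∞ (q/(uv))_∞`. -/
def qPair (q : ℝ) (u v : ℂ) : ℂ :=
  qp q (q * (u / v)) * qp q (q * (v / u)) * (qp q (q * (u * v)) * qp q (q / (u * v)))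

theorem qPair_comm (q : ℝ) (u v : ℂ) : qPair q u v = qPair q v u := by
  rw [qPair, qPair, mul_comm u v]
  ring

theorem qPair_self {q : ℝ} {u : ℂ} (hu : u ≠ 0) : qPair q u u = qp q q ^ 2 * qDen q u := by
  rw [qPair, qDen, div_self hu]
  ring_nf

theorem th_div_mul_th_mul {q : ℝ} (hq0 : 0 < q) (hq1 : q < 1) {u v : ℂ} (hu : u ≠ 0)
    (hv : v ≠ 0) :
    th q (u / v) * th q (u * v) / u = (u + u⁻¹ - (v + v⁻¹)) * qPair q u v := by
  have e : u + u⁻¹ - (v + v⁻¹) = (1 - u / v) * (1 - u * v) / u := by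
    field_simp
    ring
  rw [th, th, qp_eq_mul hq0 hq1 (u / v), qp_eq_mul hq0 hq1 (u * v), e, qPair, div_div_eq_mul_div,
    mul_div_assoc (q : ℂ) v u]
  ring

theorem prod_prod_Ioi_add {a b : ℕ} (f : Fin (a + b) → Fin (a + b) → ℂ) :
    ∏ i, ∏ j ∈ Ioi i, f i j =
      (∏ i, ∏ j ∈ Ioi i, f (Fin.castAdd b i) (Fin.castAdd b j)) *
      (∏ i, ∏ j, f (Fin.castAdd b i) (Fin.natAdd a j)) *
      ∏ i, ∏ j ∈ Ioi i, f (Fin.natAdd a i) (Fin.natAdd a j) := by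
  have h : ∀ (n : ℕ) (i : Fin n) (g : Fin n → ℂ),
      ∏ j ∈ Ioi i, g j = ∏ j, if i < j then g j else 1 := fun n i g => by
    rw [← prod_filter]
    exact prod_congr (by ext; simp) fun _ _ => rfl
  simp only [h, Fin.prod_univ_add]
  have h1 : ∀ (i : Fin a) (j : Fin b), Fin.castAdd b i < Fin.natAdd a j := fun i j => by
    simp only [Fin.lt_def, Fin.val_castAdd, Fin.val_natAdd]
    omega
  have h2 : ∀ (i : Fin b) (j : Fin a), ¬ Fin.natAdd a i < Fin.castAdd b j := fun i j =>
    (h1 j i).le.not_gt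
  have h3 : ∀ i j : Fin a, Fin.castAdd b i < Fin.castAdd b j ↔ i < j := fun i j => Iff.rfl
  have h4 : ∀ i j : Fin b, Fin.natAdd a i < Fin.natAdd a j ↔ i < j := fun i j => by
    simp only [Fin.lt_def, Fin.val_natAdd]
    omega
  simp only [h1, h2, h3, h4, if_true, if_false, prod_const_one, one_mul, prod_mul_distrib]

theorem prod_prod_eq_diag_mul {s : ℕ} (f : Fin s → Fin s → ℂ) :
    ∏ i, ∏ j, f i j = (∏ i, f i i) * ∏ i, ∏ j ∈ Ioi i, (f i j * f j i) := by
  have h := prod_prod_Ioi_mul_eq_prod_prod_off_diag fun i j => f j i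
  rw [h, ← prod_mul_distrib]
  refine prod_congr rfl fun i _ => ?_
  rw [← mul_prod_erase univ _ (mem_univ i), ← compl_singleton]

/-- Parameters for which the lattice sums through `x_1, …, x_s` reduce to single terms. -/
def qSpec (q : ℝ) {s : ℕ} (x : Fin s → ℂ) : Fin (s + s + 2) → ℂ :=
  Fin.append (Fin.append (fun j => q / x j) fun j => q * x j) fun _ => q

theorem qSpec_ne_zero {q : ℝ} (hq0 : 0 < q) {s : ℕ} {x : Fin s → ℂ} (hx : ∀ j, x j ≠ 0) (m) :
    qSpec q x m ≠ 0 := by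
  have hq : (q : ℂ) ≠ 0 := by exact_mod_cast hq0.ne'
  refine Fin.addCases (fun m => Fin.addCases (fun m => ?_) (fun m => ?_) m) (fun m => ?_) m <;>
    simp only [qSpec, Fin.append_left, Fin.append_right]
  · exact hq
  · exact div_ne_zero hq (hx m)
  · exact mul_ne_zero hq (hx m)

theorem prod_qSpec {q : ℝ} {s : ℕ} {x : Fin s → ℂ} (hx : ∀ j, x j ≠ 0) :
    ∏ m, qSpec q x m = (q : ℂ) ^ (2 * s + 2) := by
  simp only [qSpec, Fin.prod_univ_add, Fin.append_left, Fin.append_right]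
  rw [← prod_mul_distrib, prod_congr rfl fun j _ => show (q : ℂ) / x j * (q * x j) = q ^ 2 by
    have := hx j
    field_simp]
  simp
  ring

theorem qNum_qSpec (q : ℝ) {s : ℕ} (x : Fin s → ℂ) (z : ℂ) :
    qNum q (qSpec q x) z = (∏ k, qPair q z (x k)) * (qp q (q * z) * qp q (q / z)) ^ 2 := by
  simp only [qNum, qSpec, Fin.prod_univ_add, Fin.append_left, Fin.append_right]
  rw [← prod_mul_distrib, prod_const, card_univ, Fintype.card_fin]
  congr 1
  refine prod_congr rfl fun k _ => ?_
  rw [qPair, show (q : ℂ) / x k * z = q * (z / x k) by ring,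
    show (q : ℂ) / x k / z = q / (z * x k) by rw [div_div, mul_comm],
    show (q : ℂ) * x k * z = q * (z * x k) by ring, mul_div_assoc (q : ℂ)]
  ring

theorem qNum_qSpec_eq_zero {q : ℝ} (hq0 : 0 < q) {s : ℕ} {x : Fin s → ℂ} {j : Fin s}
    (hx : x j ≠ 0) {ν : ℤ} (hν : ν ≠ 0) : qNum q (qSpec q x) (qLat q (x j) ν) = 0 := by
  have hq : (q : ℂ) ≠ 0 := by exact_mod_cast hq0.ne'
  rw [qNum_qSpec, prod_eq_zero (mem_univ j), zero_mul]
  have h : ∀ k : ℕ, qp q (q * (q : ℂ) ^ (-((k : ℤ) + 1))) = 0 := fun k => by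
    refine qp_eq_zero k ?_
    rw [← zpow_natCast, ← mul_assoc, ← zpow_add_one₀ hq, ← zpow_add₀ hq]
    simp
  rw [qPair, qLat]
  rcases lt_or_gt_of_ne hν with hν | hν
  · obtain ⟨k, rfl⟩ : ∃ k : ℕ, ν = -((k : ℤ) + 1) := ⟨(-ν - 1).toNat, by omega⟩
    rw [mul_div_cancel_right₀ _ hx, h]
    ring
  · obtain ⟨k, rfl⟩ : ∃ k : ℕ, ν = (k : ℤ) + 1 := ⟨(ν - 1).toNat, by omega⟩
    rw [div_mul_cancel_right₀ hx, ← zpow_neg, h]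
    ring

theorem qSum_qSpec {q : ℝ} (hq0 : 0 < q) (p : ℕ) {s : ℕ} {x : Fin s → ℂ} {j : Fin s}
    (hx : x j ≠ 0) (f : Polynomial ℂ) :
    qSum q p (qSpec q x) f (x j) =
      f.eval (x j + (x j)⁻¹) * (qNum q (qSpec q x) (x j) / qDen q (x j)) := by
  rw [qSum, tsum_eq_single 0 fun ν hν => by
    rw [qTerm, qWeight, qNum_qSpec_eq_zero hq0 hx hν, mul_zero, zero_div, mul_zero]]
  rw [qTerm, qWeight, qLat_zero, qGauss_zero, one_mul]

theorem qDet_qSpec {q : ℝ} (hq0 : 0 < q) (hq1 : q < 1) (p : ℕ) {x : Fin (p + 1) → ℂ}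
    (hx : ∀ j, QRegular q (x j)) :
    qDet q p (qSpec q x) x =
      (∏ j, (qp q q * (qp q (q * x j) * qp q (q / x j))) ^ 2) *
      (∏ j, ∏ k ∈ Ioi j, qPair q (x j) (x k) ^ 2) *
      ∏ j, ∏ k ∈ Ioi j, (x k + (x k)⁻¹ - (x j + (x j)⁻¹)) := by
  have e1 : (Matrix.of fun i j : Fin (p + 1) =>
      qSum q p (qSpec q x) (Polynomial.X ^ (i : ℕ)) (x j)) =
      Matrix.of fun i j : Fin (p + 1) => (qNum q (qSpec q x) (x j) / qDen q (x j)) *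
        (Matrix.vandermonde fun j => x j + (x j)⁻¹).transpose i j := by
    ext i j
    simp [qSum_qSpec hq0 p (hx j).1, Matrix.vandermonde, mul_comm]
  rw [qDet, e1, Matrix.det_mul_row, Matrix.det_transpose, Matrix.det_vandermonde]
  congr 1
  simp only [qNum_qSpec]
  rw [prod_div_distrib, prod_mul_distrib, prod_prod_eq_diag_mul]
  have hD : ∏ j, qDen q (x j) ≠ 0 := prod_ne_zero_iff.2 fun j _ => qDen_ne_zero hq0 hq1 (hx j)
  have e2 : ∏ j, qPair q (x j) (x j) = (∏ _j : Fin (p + 1), qp q q ^ 2) * ∏ j, qDen q (x j) := by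
    rw [← prod_mul_distrib]
    exact prod_congr rfl fun j _ => qPair_self (hx j).1
  have e3 : ∏ j, ∏ k ∈ Ioi j, (qPair q (x j) (x k) * qPair q (x k) (x j)) =
      ∏ j, ∏ k ∈ Ioi j, qPair q (x j) (x k) ^ 2 :=
    prod_congr rfl fun j _ => prod_congr rfl fun k _ => by rw [qPair_comm q (x k), sq]
  rw [e2, e3]
  simp only [mul_pow, prod_mul_distrib]
  field_simp

theorem qp_self_ne_zero {q : ℝ} (hq0 : 0 < q) (hq1 : q < 1) : qp q q ≠ 0 := by
  refine qp_ne_zero hq0 hq1 fun i h => ?_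
  rw [← pow_succ] at h
  have : q ^ (i + 1) = 1 := by exact_mod_cast h
  exact (pow_lt_one₀ hq0.le hq1 (by omega)).ne this

theorem prod_prod_Ioi_qSpec {q : ℝ} (hq0 : 0 < q) {s : ℕ} {x : Fin s → ℂ}
    (hx : ∀ j, x j ≠ 0) :
    ∏ i, ∏ j ∈ Ioi i, qp q (qSpec q x i * qSpec q x j / q) =
      (∏ j, (qp q q * (qp q (q * x j) * qp q (q / x j)) ^ 2)) *
      (∏ j, ∏ k ∈ Ioi j, qPair q (x j) (x k)) * qp q q := by
  have hq : (q : ℂ) ≠ 0 := by exact_mod_cast hq0.ne'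
  rw [prod_prod_Ioi_add, prod_prod_Ioi_add]
  simp only [qSpec, Fin.prod_univ_add, Fin.append_left, Fin.append_right]
  have a1 : ∀ i j, (q : ℂ) / x i * (q / x j) / q = q / (x i * x j) := fun i j => by
    have := hx i
    have := hx j
    field_simp
  have a2 : ∀ i j, (q : ℂ) / x i * (q * x j) / q = q * (x j / x i) := fun i j => by
    have := hx i
    field_simp
  have a3 : ∀ i j, (q : ℂ) * x i * (q * x j) / q = q * (x i * x j) := fun i j => by
    field_simp
  have a4 : ∀ u : ℂ, u * q / q = u := fun u => by field_simp
  simp only [a1, a2, a3, a4]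
  rw [prod_prod_eq_diag_mul fun i j => qp q (q * (x j / x i))]
  have a5 : ∏ i, qp q (q * (x i / x i)) = ∏ _i : Fin s, qp q q :=
    prod_congr rfl fun i _ => by rw [div_self (hx i), mul_one]
  have a6 : ∏ i : Fin 2, ∏ _j ∈ Ioi i, qp q q = qp q q := by
    rw [Fin.prod_univ_two, show Ioi (0 : Fin 2) = {1} by decide, show Ioi (1 : Fin 2) = ∅ by decide]
    simp
  rw [a5, a6]
  simp only [prod_const, card_univ, Fintype.card_fin, qPair, prod_mul_distrib, prod_pow]
  ring

theorem qProd_qSpec {q : ℝ} (hq0 : 0 < q) (hq1 : q < 1) (p : ℕ) {x : Fin (p + 1) → ℂ}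
    (hx : ∀ j, x j ≠ 0) :
    qProd q p (qSpec q x) =
      (∏ j, (qp q q * (qp q (q * x j) * qp q (q / x j)) ^ 2)) *
      ∏ j, ∏ k ∈ Ioi j, qPair q (x j) (x k) := by
  have hq : (q : ℂ) ≠ 0 := by exact_mod_cast hq0.ne'
  rw [qProd, prod_qSpec hx, prod_prod_Ioi_qSpec hq0 hx,
    show (q : ℂ) ^ (2 * (p + 1) + 2) / q ^ (2 * p + 3) = q by
      rw [show 2 * (p + 1) + 2 = 2 * p + 3 + 1 by ring, pow_succ]
      field_simp,
    mul_div_cancel_right₀ _ (qp_self_ne_zero hq0 hq1)]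

theorem qDet_zero_congr (q : ℝ) (p : ℕ) (n n' : ℕ) (x : Fin (p + 1) → ℂ) :
    qDet q p (0 : Fin n → ℂ) x = qDet q p (0 : Fin n' → ℂ) x := by
  simp [qDet, qSum, qTerm, qWeight, qNum, qp_zero]

theorem qDet_zero_of_generic {q : ℝ} (hq0 : 0 < q) (hq1 : q < 1) (p n : ℕ)
    {x : Fin (p + 1) → ℂ} (hx : ∀ j, QRegular q (x j))
    (hgen : ∀ j k, j < k → qPair q (x j) (x k) ≠ 0) :
    qDet q p (0 : Fin n → ℂ) x = qp q q ^ (p + 1) *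
      ∏ j, ∏ k ∈ Ioi j, ((x k + (x k)⁻¹ - (x j + (x j)⁻¹)) * qPair q (x j) (x k)) := by
  have hx0 : ∀ j, x j ≠ 0 := fun j => (hx j).1
  have hqq := qp_self_ne_zero hq0 hq1
  have he : ∀ j, qp q (q * x j) * qp q (q / x j) ≠ 0 := fun j => by
    have hz := hx j
    have key : ∀ {y : ℂ}, QRegular q y → qp q (q * y) ≠ 0 := fun {y} hy => by
      refine qp_ne_zero hq0 hq1 fun i h => hy.2 ((i + 1 : ℕ) + (i + 1 : ℕ)) ?_
      rw [← mul_assoc, ← pow_succ] at h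
      rw [← Nat.cast_add, zpow_natCast, pow_add]
      linear_combination (q ^ (i + 1) * y + 1) * h
    rw [div_eq_mul_inv]
    exact mul_ne_zero (key hz) (key hz.inv)
  have hP : qProd q p (qSpec q x) ≠ 0 := by
    rw [qProd_qSpec hq0 hq1 p hx0]
    refine mul_ne_zero (prod_ne_zero_iff.2 fun j _ => mul_ne_zero hqq (pow_ne_zero _ (he j))) ?_
    exact prod_ne_zero_iff.2 fun j _ => prod_ne_zero_iff.2 fun k hk => hgen j k (mem_Ioi.1 hk)
  have hR : ∏ m, ‖qSpec q x m‖ < q ^ (2 * p + 3) := by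
    rw [← norm_prod, prod_qSpec hx0, norm_pow, norm_real, Real.norm_of_nonneg hq0.le]
    exact pow_lt_pow_right_of_lt_one₀ hq0 hq1 (by omega)
  have h := qDet_eq_qProd_mul hq0 hq1 p (by ring) (qSpec_ne_zero hq0 hx0) hR hx
  rw [qDet_zero_congr q p n (p + 1 + (p + 1) + 2)]
  refine mul_left_cancel₀ hP ?_
  rw [← h, qDet_qSpec hq0 hq1 p hx, qProd_qSpec hq0 hq1 p hx0]
  simp only [prod_mul_distrib, mul_pow, prod_pow, prod_const, card_univ, Fintype.card_fin]
  ring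

theorem qSum_qLat {q : ℝ} (hq0 : 0 < q) (p : ℕ) {n : ℕ} (t : Fin n → ℂ) (f : Polynomial ℂ)
    {ξ : ℂ} (hξ : ξ ≠ 0) (ν : ℤ) :
    qGauss q p ξ ν * qSum q p t f (qLat q ξ ν) = qSum q p t f ξ := by
  have hq : (q : ℂ) ≠ 0 := by exact_mod_cast hq0.ne'
  rw [qSum, qSum, ← tsum_mul_left, ← (Equiv.addRight ν).tsum_eq (qTerm q p t f ξ)]
  refine tsum_congr fun μ => ?_
  have e1 : qLat q (qLat q ξ ν) μ = qLat q ξ (μ + ν) := by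
    rw [qLat, qLat, qLat, zpow_add₀ hq, mul_assoc]
  have e2 : qGauss q p ξ ν * qGauss q p (qLat q ξ ν) μ = qGauss q p ξ (μ + ν) := by
    rw [qGauss, qGauss, qGauss, ← mul_pow, qLat, mul_zpow, ← zpow_mul,
      show (μ + ν) * (μ + ν) = μ * μ + ν * (2 * μ) + ν * ν by ring, mul_add 2 μ ν]
    simp only [zpow_add₀ hq, zpow_add₀ hξ]
    ring
  rw [Equiv.coe_addRight, qTerm, qTerm, qWeight, qWeight, e1, ← e2]
  ring

theorem qSum_inv (q : ℝ) (p : ℕ) {n : ℕ} (t : Fin n → ℂ) (f : Polynomial ℂ) (ξ : ℂ) :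
    qSum q p t f ξ⁻¹ = qSum q p t f ξ := by
  rw [qSum, qSum, ← (Equiv.neg ℤ).tsum_eq]
  refine tsum_congr fun μ => ?_
  rw [Equiv.neg_apply, qTerm, qTerm, qWeight_inv_neg, qLat_inv_neg, inv_inv, add_comm]

theorem qDet_eq_zero_of_proportional {q : ℝ} {p n : ℕ} {t : Fin n → ℂ} {x : Fin (p + 1) → ℂ}
    {j k : Fin (p + 1)} (hjk : j ≠ k) (c : ℂ)
    (h : ∀ f, qSum q p t f (x j) = c * qSum q p t f (x k)) : qDet q p t x = 0 := by
  rw [qDet]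
  refine Matrix.exists_mulVec_eq_zero_iff.1 ⟨Pi.single j 1 - c • Pi.single k 1, fun h0 => ?_, ?_⟩
  · have := congrFun h0 j
    simp [hjk] at this
  · rw [Matrix.mulVec_sub, Matrix.mulVec_smul]
    ext i
    simp [h]

/-- The determinant at the zero parameters. -/
theorem qDet_zero {q : ℝ} (hq0 : 0 < q) (hq1 : q < 1) (p n : ℕ)
    {x : Fin (p + 1) → ℂ} (hx : ∀ j, QRegular q (x j)) :
    qDet q p (0 : Fin n → ℂ) x = qp q q ^ (p + 1) *
      ∏ j, ∏ k ∈ Ioi j, -(th q (x j / x k) * th q (x j * x k) / x j) := by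
  have hq : (q : ℂ) ≠ 0 := by exact_mod_cast hq0.ne'
  have hx0 : ∀ j, x j ≠ 0 := fun j => (hx j).1
  have hth := fun j k => th_div_mul_th_mul hq0 hq1 (hx0 j) (hx0 k)
  by_cases hgen : ∀ j k, j < k → th q (x j / x k) * th q (x j * x k) / x j ≠ 0
  · rw [qDet_zero_of_generic hq0 hq1 p n hx fun j k hjk h => hgen j k hjk (by
      rw [hth, h, mul_zero])]
    congr 1
    refine prod_congr rfl fun j _ => prod_congr rfl fun k _ => ?_
    rw [hth]
    ring
  · push Not at hgen
    obtain ⟨j, k, hjk, h⟩ := hgen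
    have h0 : ∏ j, ∏ k ∈ Ioi j, -(th q (x j / x k) * th q (x j * x k) / x j) = 0 :=
      prod_eq_zero (mem_univ j) (prod_eq_zero (mem_Ioi.2 hjk) (by rw [h, neg_zero]))
    rw [h0, mul_zero]
    rcases mul_eq_zero.1 ((div_eq_zero_iff.1 h).resolve_right (hx0 j)) with h | h
    · have h' := mt (th_ne_zero_iff hq0 hq1 (div_ne_zero (hx0 j) (hx0 k))).2 (not_not.2 h)
      push Not at h'
      obtain ⟨ν, hν⟩ := h'
      have e : x k = qLat q (x j) ν := by
        have := hx0 k
        field_simp at hν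
        rw [qLat, hν]
      exact qDet_eq_zero_of_proportional hjk.ne (qGauss q p (x j) ν) fun f => by
        rw [e, qSum_qLat hq0 p _ _ (hx0 j)]
    · have h' := mt (th_ne_zero_iff hq0 hq1 (mul_ne_zero (hx0 j) (hx0 k))).2 (not_not.2 h)
      push Not at h'
      obtain ⟨ν, hν⟩ := h'
      have e : x k = (qLat q (x j) ν)⁻¹ := by
        rw [qLat]
        refine eq_inv_of_mul_eq_one_right ?_
        linear_combination hν
      exact qDet_eq_zero_of_proportional hjk.ne (qGauss q p (x j) ν) fun f => by
        rw [e, qSum_inv, qSum_qLat hq0 p _ _ (hx0 j)]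

theorem th_zpow_mul {q : ℝ} (hq0 : 0 < q) (hq1 : q < 1) {u : ℂ} (hu : u ≠ 0) (ν : ℤ) :
    th q ((q : ℂ) ^ ν * u) * ((-1) ^ ν * (q : ℂ) ^ (ν * (ν - 1) / 2) * u ^ ν) = th q u := by
  have hq : (q : ℂ) ≠ 0 := by exact_mod_cast hq0.ne'
  have hm : (-1 : ℂ) ≠ 0 := by simp
  have step : ∀ ν : ℤ, th q ((q : ℂ) ^ (ν + 1) * u) *
      ((-1) ^ (ν + 1) * (q : ℂ) ^ ((ν + 1) * (ν + 1 - 1) / 2) * u ^ (ν + 1)) =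
      th q ((q : ℂ) ^ ν * u) * ((-1) ^ ν * (q : ℂ) ^ (ν * (ν - 1) / 2) * u ^ ν) := by
    intro ν
    have h := th_mul_left hq0 hq1 (mul_ne_zero (zpow_ne_zero ν hq) hu)
    rw [← mul_assoc, mul_comm (q : ℂ), ← zpow_add_one₀ hq] at h
    rw [← h, show (ν + 1) * (ν + 1 - 1) = ν * (ν - 1) + ν * 2 by ring,
      Int.add_mul_ediv_right _ _ two_ne_zero, zpow_add_one₀ hm, zpow_add_one₀ hu,
      zpow_add₀ hq (ν * (ν - 1) / 2) ν]
    ring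
  induction ν using Int.induction_on with
  | zero => simp
  | succ ν ih => rw [step, ih]
  | pred ν ih =>
    rw [← ih]
    have := step (-(ν : ℤ) - 1)
    rw [sub_add_cancel] at this
    exact this.symm

theorem prod_cpow_lattice (q : ℝ) (p : ℕ) {n : ℕ} (hn : n = 2 * p + 4)
    (a α : Fin n → ℂ) (ξ : ℂ) (ν : ℤ) :
    ∏ m, ((q : ℂ) ^ ((ν : ℂ) / 2) * a m ^ (-ν) * ξ ^ ((1 : ℂ) / 2 - α m)) =
      (q : ℂ) ^ (ν * (p + 2)) * (∏ m, a m) ^ (-ν) * ∏ m, ξ ^ ((1 : ℂ) / 2 - α m) := by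
  rw [prod_mul_distrib, prod_mul_distrib, prod_const, card_univ, Fintype.card_fin, prod_zpow]
  congr 2
  rw [hn, show 2 * p + 4 = 2 * (p + 2) by ring, pow_mul, ← Complex.cpow_nat_mul,
    show ((2 : ℕ) : ℂ) * ((ν : ℂ) / 2) = ν by push_cast; ring, Complex.cpow_intCast,
    ← zpow_natCast, ← zpow_mul]
  push_cast
  rfl

theorem prod_cpow_eq (p : ℕ) {n : ℕ} (hn : n = 2 * p + 4) (α : Fin n → ℂ) {ξ : ℂ} (hξ : ξ ≠ 0) :
    ∏ m, ξ ^ ((1 : ℂ) / 2 - α m) = ξ ^ (((p + 1 : ℕ) : ℂ) - ∑ m, α m) * ξ := by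
  have h : ∀ F : Finset (Fin n), ∏ m ∈ F, ξ ^ ((1 : ℂ) / 2 - α m) =
      ξ ^ (∑ m ∈ F, ((1 : ℂ) / 2 - α m)) := by
    intro F
    induction F using Finset.induction_on with
    | empty => simp
    | insert m F hm ih => rw [prod_insert hm, sum_insert hm, ih, Complex.cpow_add _ _ hξ]
  have h1 := Complex.cpow_add (((p + 1 : ℕ) : ℂ) - ∑ m, α m) 1 hξ
  rw [Complex.cpow_one] at h1
  rw [h, ← h1]
  congr 1
  simp [hn]
  ring

theorem jSummand_eq {q : ℝ} (hq0 : 0 < q) (hq1 : q < 1) (p : ℕ) {a α : Fin (2 * (p + 1) + 2) → ℂ}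
    (ha : ∀ m, a m ≠ 0) {ξ : ℂ} (hξ : ξ ≠ 0) (h2 : th q (ξ ^ 2) ≠ 0)
    (hth : ∀ m, th q (a m * ξ) ≠ 0) (φ : ℂ → ℂ) (ν : ℤ) :
    jSummand q (p + 1) a α φ ξ ν = ThetaBC q (p + 1) a α ξ *
      (φ (qLat q ξ ν) * qWeight q p (fun m => q / a m) ξ ν) := by
  have hq : (q : ℂ) ≠ 0 := by exact_mod_cast hq0.ne'
  have hreg := qRegular_of_th hq0 hq1 hξ h2
  have hz := hreg.qLat hq0 ν
  have hz0 := hz.1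
  have hD := qDen_ne_zero hq0 hq1 hz
  have h1 := hz.sq_ne_one
  have hA : ∏ m, a m ≠ 0 := prod_ne_zero_iff.2 fun m _ => ha m
  have hthz : ∀ m, th q (a m * qLat q ξ ν) ≠ 0 := fun m => by
    rw [qLat, mul_left_comm]
    exact th_zpow_mul_ne_zero hq0 hq1 (mul_ne_zero (ha m) hξ) (hth m) ν
  have e1 : PhiLat q (p + 1) a α ξ ν = (q : ℂ) ^ (ν * (p + 2)) * (∏ m, a m) ^ (-ν) *
      (ξ ^ (((p + 1 : ℕ) : ℂ) - ∑ m, α m) * ξ) *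
      (qNum q (fun m => q / a m) (qLat q ξ ν) / ∏ m, th q (a m * qLat q ξ ν)) := by
    rw [PhiLat, prod_mul_distrib, prod_cpow_lattice q p (by ring) a α ξ,
      prod_cpow_eq p (by ring) α hξ, qNum, ← prod_div_distrib]
    congr 1
    refine prod_congr rfl fun m _ => ?_
    have ha' := ha m
    have h3 := hthz m
    rw [th] at h3 ⊢
    rw [← qLat, mul_comm (qLat q ξ ν) (a m), show (q : ℂ) / a m * qLat q ξ ν = q * qLat q ξ ν / a m by
      ring, div_div]
    rw [mul_div_mul_right _ _ (right_ne_zero_of_mul h3)]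
  have e2 : ∏ m, th q (a m * ξ) = (∏ m, th q (a m * qLat q ξ ν)) *
      ((q : ℂ) ^ (ν * (ν - 1) * (p + 2)) * (∏ m, a m) ^ ν * (ξ ^ ν) ^ (2 * p + 4)) := by
    have e : ∀ m, th q (a m * ξ) = th q (a m * qLat q ξ ν) *
        ((-1) ^ ν * (q : ℂ) ^ (ν * (ν - 1) / 2) * ξ ^ ν * a m ^ ν) := fun m => by
      rw [← th_zpow_mul hq0 hq1 (mul_ne_zero (ha m) hξ) ν, qLat, mul_left_comm, mul_zpow]
      ring_nf
    simp only [e]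
    rw [prod_mul_distrib, prod_mul_distrib, prod_const, card_univ, Fintype.card_fin, prod_zpow]
    congr 1
    generalize (∏ m, a m) ^ ν = A
    rw [show 2 * (p + 1) + 2 = 2 * (p + 2) by ring, show 2 * p + 4 = 2 * (p + 2) by ring, mul_pow,
      mul_pow]
    have s1 : ((-1 : ℂ) ^ ν) ^ (2 * (p + 2)) = 1 := by
      rw [pow_mul, pow_two, ← mul_zpow]
      simp
    have s2 : ((q : ℂ) ^ (ν * (ν - 1) / 2)) ^ (2 * (p + 2)) = (q : ℂ) ^ (ν * (ν - 1) * (p + 2)) := by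
      rw [← zpow_natCast, ← zpow_mul]
      congr 1
      push_cast
      rw [← mul_assoc, Int.ediv_mul_cancel (Int.even_mul_pred_self ν).two_dvd]
    rw [s1, s2]
    ring
  have e3 : th q (ξ ^ 2) = (1 - qLat q ξ ν ^ 2) * qDen q (qLat q ξ ν) *
      ((q : ℂ) ^ (ν * (2 * ν - 1)) * (ξ ^ ν) ^ 4) := by
    rw [← th_zpow_mul hq0 hq1 (pow_ne_zero 2 hξ) (2 * ν)]
    have s1 : ((-1 : ℂ) ^ (2 * ν)) = 1 := by rw [zpow_mul]; simp
    have s2 : (q : ℂ) ^ (2 * ν) * ξ ^ 2 = qLat q ξ ν ^ 2 := by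
      rw [qLat, mul_pow, mul_comm 2, zpow_mul]
      norm_cast
    have s3 : (ξ ^ 2) ^ (2 * ν) = (ξ ^ ν) ^ 4 := by
      rw [← zpow_natCast, ← zpow_mul, ← zpow_natCast, ← zpow_mul]
      congr 1
      push_cast
      ring
    rw [s1, s2, s3, mul_assoc 2, Int.mul_ediv_cancel_left _ two_ne_zero, th,
      qp_eq_mul hq0 hq1 (qLat q ξ ν ^ 2), qDen]
    ring
  have hP : ∏ m, th q (a m * qLat q ξ ν) ≠ 0 := prod_ne_zero_iff.2 fun m _ => hthz m
  have e4 : (qLat q ξ ν)⁻¹ - qLat q ξ ν = (1 - qLat q ξ ν ^ 2) / qLat q ξ ν := by field_simp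
  have e5 : qGauss q p ξ ν = (q : ℂ) ^ (ν * ν * p) * (ξ ^ ν) ^ (2 * p) := by
    rw [qGauss, mul_pow, mul_comm 2 ν, ← zpow_natCast, ← zpow_mul, zpow_mul ξ, pow_mul]
    norm_cast
  have e6 : (q : ℂ) ^ (ν * (p + 2)) * (q : ℂ) ^ (ν * (ν - 1) * (p + 2)) =
      (q : ℂ) ^ (ν * (2 * ν - 1)) * (q : ℂ) ^ (ν * ν * p) * (q : ℂ) ^ ν := by
    simp only [← zpow_add₀ hq]
    congr 1
    ring
  have hξν : ξ ^ ν ≠ 0 := zpow_ne_zero _ hξ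
  have hAν : (∏ m, a m) ^ ν ≠ 0 := zpow_ne_zero _ hA
  have hqe : ∀ k : ℤ, (q : ℂ) ^ k ≠ 0 := fun k => zpow_ne_zero k hq
  rw [jSummand, e1, ThetaBC, e2, e3, qWeight, e5, ← qLat, e4, zpow_neg]
  have e7 : qLat q ξ ν = (q : ℂ) ^ ν * ξ := rfl
  generalize qNum q (fun m => q / a m) (qLat q ξ ν) = N
  generalize φ (qLat q ξ ν) = f
  generalize ξ ^ (((p + 1 : ℕ) : ℂ) - ∑ m, α m) = c
  generalize ∏ m, th q (a m * qLat q ξ ν) = P at *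
  generalize qDen q (qLat q ξ ν) = D at *
  have hw : 1 - qLat q ξ ν ^ 2 ≠ 0 := h1
  generalize 1 - qLat q ξ ν ^ 2 = w at *
  rw [e7]
  have g1 := hqe (ν * (p + 2))
  have g2 := hqe (ν * (ν - 1) * (p + 2))
  have g3 := hqe (ν * (2 * ν - 1))
  have g4 := hqe (ν * ν * p)
  have g5 := hqe ν
  generalize (q : ℂ) ^ (ν * (p + 2)) = q1 at *
  generalize (q : ℂ) ^ (ν * (ν - 1) * (p + 2)) = q2 at *
  generalize (q : ℂ) ^ (ν * (2 * ν - 1)) = q3 at *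
  generalize (q : ℂ) ^ (ν * ν * p) = q4 at *
  generalize (q : ℂ) ^ ν = q5 at *
  generalize (∏ m, a m) ^ ν = A at *
  generalize ξ ^ ν = y at *
  have e8 : q1 = q3 * q4 * q5 / q2 := by
    rw [eq_div_iff g2, e6]
  rw [e8, show 2 * p + 4 = 2 * p + 2 + 2 by ring, pow_add y, pow_add y]
  field_simp

theorem chiC_eq_eval {z : ℂ} (hz : z ≠ 0) (h : 1 - z ^ 2 ≠ 0) (i : ℕ) :
    chiC i z = (Polynomial.Chebyshev.S ℂ i).eval (z + z⁻¹) := by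
  have e := eval_S_mul_sub hz i
  have h' : z - z⁻¹ ≠ 0 := by
    rw [show z - z⁻¹ = -(1 - z ^ 2) / z by field_simp; ring]
    exact div_ne_zero (neg_ne_zero.2 h) hz
  rw [chiC, div_eq_iff h']
  have e' : ((i : ℤ) + 1) = ((i + 1 : ℕ) : ℤ) := by push_cast; rfl
  rw [e', zpow_natCast, zpow_natCast] at e
  linear_combination e

theorem jInt_chiC_eq {q : ℝ} (hq0 : 0 < q) (hq1 : q < 1) (p : ℕ)
    {a α : Fin (2 * (p + 1) + 2) → ℂ} (ha : ∀ m, a m ≠ 0) {ξ : ℂ} (hξ : ξ ≠ 0)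
    (hΘ : ThetaBC q (p + 1) a α ξ ≠ 0) (h2 : th q (ξ ^ 2) ≠ 0) (hth : ∀ m, th q (a m * ξ) ≠ 0)
    (i : ℕ) :
    jInt q (p + 1) a α (chiC i) ξ / ThetaBC q (p + 1) a α ξ =
      (1 - q) * qSum q p (fun m => q / a m) (Polynomial.Chebyshev.S ℂ i) ξ := by
  rw [jInt, div_eq_iff hΘ, mul_assoc, qSum, ← tsum_mul_right]
  congr 1
  refine tsum_congr fun ν => ?_
  have hz := (qRegular_of_th hq0 hq1 hξ h2).qLat hq0 ν
  rw [jSummand_eq hq0 hq1 p ha hξ h2 hth, qTerm, chiC_eq_eval hz.1 hz.sq_ne_one]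
  ring

theorem lt_norm_prod_of_summable {q : ℝ} (hq0 : 0 < q) (hq1 : q < 1) (p : ℕ)
    {a α : Fin (2 * (p + 1) + 2) → ℂ} (ha : ∀ m, a m ≠ 0) {ξ : ℂ} (hξ : ξ ≠ 0)
    (h2 : th q (ξ ^ 2) ≠ 0)
    (hs : Summable fun ν : ℤ => jSummand q (p + 1) a α (chiC p) ξ ν) : q < ‖∏ m, a m‖ := by
  have hq : (q : ℂ) ≠ 0 := by exact_mod_cast hq0.ne'
  have hA : ∏ m, a m ≠ 0 := prod_ne_zero_iff.2 fun m _ => ha m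
  have hreg := qRegular_of_th hq0 hq1 hξ h2
  by_contra hle
  rw [not_lt] at hle
  have h0 : Filter.Tendsto (fun k : ℕ => jSummand q (p + 1) a α (chiC p) ξ k) Filter.atTop
      (nhds 0) :=
    (hs.comp_injective (i := fun k : ℕ => (k : ℤ)) Nat.cast_injective).tendsto_atTop_zero
  let g : ℂ → ℂ := fun z => ∏ m, (qp q (q / a m * z) / qp q (a m * z))
  have hg : Filter.Tendsto g (nhds 0) (nhds 1) := by
    have hqp := tendsto_qp_zero hq0 hq1
    have hmul : ∀ c : ℂ, Filter.Tendsto (fun z : ℂ => c * z) (nhds 0) (nhds 0) := fun c => by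
      have : Continuous fun z : ℂ => c * z := by fun_prop
      simpa using this.tendsto 0
    have h := tendsto_finsetProd (f := fun m z => qp q (q / a m * z) / qp q (a m * z)) univ
      fun m _ => (hqp.comp (hmul (q / a m))).div (hqp.comp (hmul (a m))) one_ne_zero
    simp only [div_one, prod_const_one] at h
    exact h
  have hlim : Filter.Tendsto (fun k : ℕ => (ξ⁻¹ ^ (p + 1) -
      (qLat q 1 k * qLat q 1 k) ^ (p + 1) * ξ ^ (p + 1)) *
        (∏ m, ξ ^ ((1 : ℂ) / 2 - α m)) * g (qLat q ξ k)) Filter.atTop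
      (nhds (ξ⁻¹ ^ (p + 1) * (∏ m, ξ ^ ((1 : ℂ) / 2 - α m)))) := by
    have h1 := tendsto_qLat hq0 hq1 1
    have h3 := ((((h1.mul h1).pow (p + 1)).mul_const (ξ ^ (p + 1))).const_sub
      (ξ⁻¹ ^ (p + 1))).mul_const (∏ m, ξ ^ ((1 : ℂ) / 2 - α m))
    simpa using h3.mul (hg.comp (tendsto_qLat hq0 hq1 ξ))
  have hzero : Filter.Tendsto (fun k : ℕ => (ξ⁻¹ ^ (p + 1) -
      (qLat q 1 k * qLat q 1 k) ^ (p + 1) * ξ ^ (p + 1)) *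
        (∏ m, ξ ^ ((1 : ℂ) / 2 - α m)) * g (qLat q ξ k)) Filter.atTop (nhds 0) := by
    refine squeeze_zero_norm (fun k => ?_) (by simpa using h0.norm)
    have e : (ξ⁻¹ ^ (p + 1) - (qLat q 1 k * qLat q 1 k) ^ (p + 1) * ξ ^ (p + 1)) *
        (∏ m, ξ ^ ((1 : ℂ) / 2 - α m)) * g (qLat q ξ k) =
        ((∏ m, a m) / q) ^ k * jSummand q (p + 1) a α (chiC p) ξ k := by
      have hz := hreg.qLat hq0 k
      have e1 := eval_S_mul_sub hz.1 p
      have e' : ((p : ℤ) + 1) = ((p + 1 : ℕ) : ℤ) := by push_cast; rfl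
      rw [e', zpow_natCast, zpow_natCast] at e1
      have e2 : PhiLat q (p + 1) a α ξ k = (q : ℂ) ^ ((k : ℤ) * (p + 2)) *
          (∏ m, a m) ^ (-(k : ℤ)) * (∏ m, ξ ^ ((1 : ℂ) / 2 - α m)) * g (qLat q ξ k) := by
        rw [PhiLat, prod_mul_distrib, prod_cpow_lattice q p (by ring) a α ξ]
        congr 1
        refine prod_congr rfl fun m _ => ?_
        rw [← qLat, mul_comm (qLat q ξ k) (a m), div_mul_eq_mul_div]
      rw [jSummand, ← qLat, chiC_eq_eval hz.1 hz.sq_ne_one,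
        mul_right_comm (Polynomial.eval _ _), e1, e2]
      have e3 : (q : ℂ) ^ ((k : ℤ) * (p + 2)) = q ^ k * (q ^ k) ^ (p + 1) := by
        rw [← pow_succ', ← pow_mul, ← zpow_natCast]
        congr 1
      have e4 : (qLat q ξ k)⁻¹ ^ (p + 1) = ((q : ℂ) ^ k)⁻¹ ^ (p + 1) * ξ⁻¹ ^ (p + 1) := by
        rw [qLat, zpow_natCast, mul_inv, mul_pow]
      have e5 : qLat q ξ k ^ (p + 1) = ((q : ℂ) ^ k) ^ (p + 1) * ξ ^ (p + 1) := by
        rw [qLat, zpow_natCast, mul_pow]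
      have e6 : ((q : ℂ) ^ k)⁻¹ ^ (p + 1) * ((q : ℂ) ^ k) ^ (p + 1) = 1 := by
        rw [← mul_pow, inv_mul_cancel₀ (pow_ne_zero _ hq), one_pow]
      have e7 : ((∏ m, a m) / q) ^ k * (q ^ k * (∏ m, a m) ^ (-(k : ℤ))) = 1 := by
        rw [zpow_neg, zpow_natCast, div_pow]
        field_simp
      have e8 : qLat q 1 k = (q : ℂ) ^ k := by rw [qLat, zpow_natCast, mul_one]
      rw [e3, e4, e5, e8, mul_pow]
      generalize g (qLat q ξ k) = G
      generalize ∏ m, ξ ^ ((1 : ℂ) / 2 - α m) = c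
      linear_combination (-(ξ⁻¹ ^ (p + 1)) * c * G) * e6 -
        (c * G * (((q : ℂ) ^ k)⁻¹ ^ (p + 1) * ξ⁻¹ ^ (p + 1) -
          ((q : ℂ) ^ k) ^ (p + 1) * ξ ^ (p + 1)) * ((q : ℂ) ^ k) ^ (p + 1)) * e7
    rw [e, norm_mul, norm_pow, norm_div, norm_real, Real.norm_of_nonneg hq0.le]
    exact mul_le_of_le_one_left (norm_nonneg _)
      (pow_le_one₀ (by positivity) ((div_le_one hq0).2 hle))
  refine mul_ne_zero (pow_ne_zero _ (inv_ne_zero hξ)) (prod_ne_zero_iff.2 fun m _ => ?_)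
    (tendsto_nhds_unique hlim hzero)
  rw [Ne, Complex.cpow_eq_zero_iff]
  exact fun h => hξ h.1

theorem det_rev {p : ℕ} (M : Matrix (Fin (p + 1)) (Fin (p + 1)) ℂ) :
    (M.submatrix Fin.rev id).det = (∏ j : Fin (p + 1), ∏ _k ∈ Ioi j, (-1)) * M.det := by
  have h := Matrix.det_permute Fin.revPerm M
  have e : ((Equiv.Perm.sign (Fin.revPerm : Equiv.Perm (Fin (p + 1))) : ℤ) : ℂ) =
      ∏ j : Fin (p + 1), ∏ _k ∈ Ioi j, (-1) := by
    rw [Equiv.Perm.sign_eq_prod_prod_Ioi]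
    push_cast
    refine prod_congr rfl fun j _ => prod_congr rfl fun k hk => ?_
    simp [(mem_Ioi.1 hk).not_gt]
  rw [e] at h
  exact h

theorem det_qSum_S {q : ℝ} (hq0 : 0 < q) (hq1 : q < 1) (p : ℕ) {n : ℕ} (hn : n = 2 * p + 4)
    {t : Fin n → ℂ} (hR : ∏ m, ‖t m‖ < q ^ (2 * p + 3)) {x : Fin (p + 1) → ℂ}
    (hx : ∀ j, QRegular q (x j)) :
    (Matrix.of fun i j : Fin (p + 1) =>
      qSum q p t (Polynomial.Chebyshev.S ℂ (i : ℕ)) (x j)).det = qDet q p t x := by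
  have hR' : ∏ m, ‖t m‖ < q ^ (p + 3 + p) := by
    rwa [show p + 3 + p = 2 * p + 3 by ring]
  have h := det_linear_monic (qSumLin q p p t x)
    (fun i : Fin (p + 1) => Polynomial.Chebyshev.S ℂ (i : ℕ))
    (fun i => (natDegree_S_and_monic i).1) (fun i => (natDegree_S_and_monic i).2)
  have e1 : ∀ i : Fin (p + 1), qSumLin q p p t x (Polynomial.Chebyshev.S ℂ (i : ℕ)) =
      fun j => qSum q p t (Polynomial.Chebyshev.S ℂ (i : ℕ)) (x j) := fun i =>
    qSumLin_apply hq0 hq1 p hn hR' ((natDegree_S_and_monic i).1.trans_le (Nat.lt_succ_iff.1 i.2)) hx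
  have e2 : ∀ i : Fin (p + 1), qSumLin q p p t x (Polynomial.X ^ (i : ℕ)) =
      fun j => qSum q p t (Polynomial.X ^ (i : ℕ)) (x j) := fun i =>
    qSumLin_apply hq0 hq1 p hn hR'
      ((Polynomial.natDegree_X_pow_le _).trans (Nat.lt_succ_iff.1 i.2)) hx
  simp only [e1, e2] at h
  exact h

/-- The determinant formula
`det(⟨⟨χ_{(s-i)}, x_j⟩⟩) = (1-q)^s (q)_∞^s ∏_{i<j}(q a_i⁻¹ a_j⁻¹)_∞ / (q a₁⁻¹⋯a_{2s+2}⁻¹)_∞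
⋅ ∏_{j<k} θ(x_j/x_k) θ(x_j x_k)/x_j`, and — whenever the right-hand side is nonzero —
the regularized Jackson integrals of the characters `χ_{(s-1)}, …, χ_{(0)}` are linearly
independent. -/
theorem stmt10 (q : ℝ) (hq0 : 0 < q) (hq1 : q < 1) (s : ℕ) (hs : 1 ≤ s)
    (a α : Fin (2 * s + 2) → ℂ) (ha : ∀ m, a m = (q : ℂ) ^ α m)
    (hbal : ∏ m, a m ≠ 1)
    (x : Fin s → ℂ) (hx : ∀ i, x i ≠ 0)
    (hconv : ∀ i j : Fin s, Summable fun ν : ℤ =>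
      ‖jSummand q s a α (chiC (s - 1 - (i : ℕ))) (x j) ν‖)
    (hΘ : ∀ j, ThetaBC q s a α (x j) ≠ 0) :
    (Matrix.of fun i j : Fin s =>
        jInt q s a α (chiC (s - 1 - (i : ℕ))) (x j) / ThetaBC q s a α (x j)).det =
      (1 - (q : ℂ)) ^ s * qp q (q : ℂ) ^ s *
        (∏ i, ∏ j ∈ Ioi i, qp q ((q : ℂ) * (a i)⁻¹ * (a j)⁻¹)) /
          qp q ((q : ℂ) * ∏ m, (a m)⁻¹) *
        ∏ j, ∏ k ∈ Ioi j, (th q (x j / x k) * th q (x j * x k) / x j) ∧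
    ((1 - (q : ℂ)) ^ s * qp q (q : ℂ) ^ s *
        (∏ i, ∏ j ∈ Ioi i, qp q ((q : ℂ) * (a i)⁻¹ * (a j)⁻¹)) /
          qp q ((q : ℂ) * ∏ m, (a m)⁻¹) *
        ∏ j, ∏ k ∈ Ioi j, (th q (x j / x k) * th q (x j * x k) / x j) ≠ 0 →
      LinearIndependent ℂ fun i : Fin s => fun ξ : ℂ =>
        jInt q s a α (chiC (s - 1 - (i : ℕ))) ξ / ThetaBC q s a α ξ) := by
  obtain ⟨p, rfl⟩ := Nat.exists_eq_add_of_le' hs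
  have hq : (q : ℂ) ≠ 0 := by exact_mod_cast hq0.ne'
  have ha0 : ∀ m, a m ≠ 0 := fun m => by
    rw [ha, Ne, Complex.cpow_eq_zero_iff]
    exact fun h => hq h.1
  have h2 : ∀ j, th q (x j ^ 2) ≠ 0 := fun j h => hΘ j (by simp [ThetaBC, h])
  have hth : ∀ j m, th q (a m * x j) ≠ 0 := fun j m h => hΘ j (by
    rw [ThetaBC, prod_eq_zero (mem_univ m) h, div_zero])
  have hreg : ∀ j, QRegular q (x j) := fun j => qRegular_of_th hq0 hq1 (hx j) (h2 j)
  have hA : q < ‖∏ m, a m‖ :=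
    lt_norm_prod_of_summable (α := α) hq0 hq1 p ha0 (hx 0) (h2 0) (hconv 0 0).of_norm
  have hn : 2 * (p + 1) + 2 = 2 * p + 4 := by ring
  have hprod : ∏ m, (q : ℂ) / a m = q ^ (2 * p + 3) * (q * ∏ m, (a m)⁻¹) := by
    simp only [div_eq_mul_inv]
    rw [prod_mul_distrib, prod_const, card_univ, Fintype.card_fin]
    ring
  have hR : ∏ m, ‖(q : ℂ) / a m‖ < q ^ (2 * p + 3) := by
    rw [← norm_prod, hprod, norm_mul, norm_pow, norm_mul, norm_real, Real.norm_of_nonneg hq0.le,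
      prod_inv_distrib, norm_inv]
    refine mul_lt_of_lt_one_right (by positivity) ?_
    rw [← div_eq_mul_inv]
    exact (div_lt_one (hq0.trans hA)).2 hA
  have hdet : (Matrix.of fun i j : Fin (p + 1) =>
      jInt q (p + 1) a α (chiC (p + 1 - 1 - (i : ℕ))) (x j) / ThetaBC q (p + 1) a α (x j)).det =
      (1 - (q : ℂ)) ^ (p + 1) * qp q (q : ℂ) ^ (p + 1) *
        (∏ i, ∏ j ∈ Ioi i, qp q ((q : ℂ) * (a i)⁻¹ * (a j)⁻¹)) /
          qp q ((q : ℂ) * ∏ m, (a m)⁻¹) *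
        ∏ j, ∏ k ∈ Ioi j, (th q (x j / x k) * th q (x j * x k) / x j) := by
    have e : (Matrix.of fun i j : Fin (p + 1) =>
        jInt q (p + 1) a α (chiC (p + 1 - 1 - (i : ℕ))) (x j) / ThetaBC q (p + 1) a α (x j)) =
        (1 - (q : ℂ)) • (Matrix.of fun i j : Fin (p + 1) => qSum q p (fun m => q / a m)
          (Polynomial.Chebyshev.S ℂ (i : ℕ)) (x j)).submatrix Fin.rev id := by
      ext i j
      simp only [Matrix.of_apply, Matrix.smul_apply, Matrix.submatrix_apply, id, smul_eq_mul,
        Fin.val_rev]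
      rw [jInt_chiC_eq hq0 hq1 p ha0 (hx j) (hΘ j) (h2 j) (hth j),
        show p + 1 - 1 - (i : ℕ) = p + 1 - (i + 1) by omega]
    have e1 : qProd q p (fun m => (q : ℂ) / a m) =
        (∏ i, ∏ j ∈ Ioi i, qp q ((q : ℂ) * (a i)⁻¹ * (a j)⁻¹)) /
          qp q ((q : ℂ) * ∏ m, (a m)⁻¹) := by
      rw [qProd, hprod, mul_div_cancel_left₀ _ (pow_ne_zero _ hq)]
      congr 1
      refine prod_congr rfl fun i _ => prod_congr rfl fun j _ => congrArg (qp q) ?_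
      have := ha0 i
      have := ha0 j
      field_simp
    have e2 : (∏ j : Fin (p + 1), ∏ _k ∈ Ioi j, (-1 : ℂ)) *
        ∏ j, ∏ k ∈ Ioi j, -(th q (x j / x k) * th q (x j * x k) / x j) =
        ∏ j, ∏ k ∈ Ioi j, (th q (x j / x k) * th q (x j * x k) / x j) := by
      simp only [← prod_mul_distrib, neg_one_mul, neg_neg]
    rw [e, Matrix.det_smul, Fintype.card_fin, det_rev, det_qSum_S hq0 hq1 p hn hR hreg,
      qDet_eq_qProd_mul hq0 hq1 p hn (fun m => div_ne_zero hq (ha0 m)) hR hreg,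
      qDet_zero hq0 hq1 p _ hreg, e1, ← e2]
    ring
  refine ⟨hdet, fun hne => ?_⟩
  rw [← hdet] at hne
  exact LinearIndependent.of_comp (LinearMap.funLeft ℂ ℂ x)
    (Matrix.linearIndependent_rows_of_det_ne_zero hne)
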